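/- arXiv:2511.21263 — 8 statements merged into one kernel-verified Lean document; each statement's English description precedes it below -/
import Mathlib

section
/- Bifurcation Logic is a conservative extension of the modal logic S4: a BL formula containing no occurrence of ∗ and no occurrence of —∗ is valid in BL (true at every world of every BL model) if and only if it is valid in every Kripke model over a reflexive and transitive frame (i.e., it is S4-valid). -/
/-- Formulas of Bifurcation Logic over a countable set of propositional
letters (identified with `ℕ`). -/
inductive BLForm : Type
  | atom : ℕ → BLForm
  | neg : BLForm → BLForm
  | conj : BLForm → BLForm → BLForm
  | box : BLForm → BLForm
  | star : BLForm → BLForm → BLForm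
  | wand : BLForm → BLForm → BLForm

namespace BLForm

/-- A ∨ B := ¬(¬A ∧ ¬B) -/
def or (A B : BLForm) : BLForm := neg (conj (neg A) (neg B))

/-- A → B := ¬A ∨ B -/
def imp (A B : BLForm) : BLForm := or (neg A) B

/-- A ↔ B := (A → B) ∧ (B → A) -/
def iff (A B : BLForm) : BLForm := conj (imp A B) (imp B A)

/-- ◇A := ¬◻¬A -/
def dia (A : BLForm) : BLForm := neg (box (neg A))

/-- ⊤ := A ∨ ¬A (for a fixed propositional letter) -/
def top : BLForm := or (atom 0) (neg (atom 0))

end BLForm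

/-- `w1 # w2` : two elements of a partial order are separated if neither
`w1 ≤ w2` nor `w2 ≤ w1`. -/
def SepW {W : Type} [PartialOrder W] (w1 w2 : W) : Prop := ¬ w1 ≤ w2 ∧ ¬ w2 ≤ w1

/-- The bifurcation relation: `Rel(w, w1, w2) ⟺ w ≤ w1 ∧ w ≤ w2 ∧ w1 # w2`. -/
def BifRel {W : Type} [PartialOrder W] (w w1 w2 : W) : Prop :=
  w ≤ w1 ∧ w ≤ w2 ∧ SepW w1 w2

/-- `Rooted W` : some `r` lies below every element. -/
def Rooted (W : Type) [PartialOrder W] : Prop := ∃ r : W, ∀ w : W, r ≤ w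

/-- A BL model on a partial order `W`: the order must be rooted, must have the
persistent separation property, and is equipped with a valuation. -/
structure BLModel (W : Type) [PartialOrder W] where
  rooted : Rooted W
  persist : ∀ w1 w2 w1' : W, SepW w1 w2 → w1 ≤ w1' → SepW w1' w2
  V : W → ℕ → Prop

/-- Satisfaction of a BL formula at a world, relative to a valuation on a
partial order (the frame conditions play no role in the clauses). -/
def Sat {W : Type} [PartialOrder W] (V : W → ℕ → Prop) : BLForm → W → Prop
  | .atom p, w => V w p
  | .neg A, w => ¬ Sat V A w
  | .conj A B, w => Sat V A w ∧ Sat V B w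
  | .box A, w => ∀ w' : W, w ≤ w' → Sat V A w'
  | .star A B, w => ∃ w1 w2 : W, BifRel w w1 w2 ∧ Sat V A w1 ∧ Sat V B w2
  | .wand A B, w => ∀ w1 w2 : W, BifRel w2 w w1 → Sat V A w1 → Sat V B w2

/-- Validity in BL: true at every world of every BL model. -/
def BLValid (A : BLForm) : Prop :=
  ∀ (W : Type) [PartialOrder W] (M : BLModel W) (w : W), Sat M.V A w

/-- A formula containing no occurrence of `∗` and no occurrence of `—∗`. -/
def StarWandFree : BLForm → Prop
  | .atom _ => True
  | .neg A => StarWandFree A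
  | .conj A B => StarWandFree A ∧ StarWandFree B
  | .box A => StarWandFree A
  | .star _ _ => False
  | .wand _ _ => False

/-- Standard Kripke satisfaction for the modal (∗/—∗-free) fragment over an
arbitrary accessibility relation; the clauses for `∗` and `—∗` are vacuous
(`False`) and irrelevant for ∗/—∗-free formulas. -/
def S4Sat {W : Type} (R : W → W → Prop) (V : W → ℕ → Prop) : BLForm → W → Prop
  | .atom p, w => V w p
  | .neg A, w => ¬ S4Sat R V A w
  | .conj A B, w => S4Sat R V A w ∧ S4Sat R V B w
  | .box A, w => ∀ w' : W, R w w' → S4Sat R V A w'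
  | .star _ _, _ => False
  | .wand _ _, _ => False

/-- S4-validity: truth at every world of every Kripke model over a reflexive
and transitive frame. -/
def S4Valid (A : BLForm) : Prop :=
  ∀ (W : Type) (R : W → W → Prop), Reflexive R → Transitive R →
    ∀ (V : W → ℕ → Prop) (w : W), S4Sat R V A w

/-- Satisfaction is invariant under bounded morphisms from partial orders. -/
theorem sat_iff_s4Sat {T W : Type} [PartialOrder T] {R : W → W → Prop} {V : W → ℕ → Prop}
    (f : T → W) (forth : ∀ s t, s ≤ t → R (f s) (f t))
    (back : ∀ s v, R (f s) v → ∃ t, s ≤ t ∧ f t = v) (A : BLForm) (hA : StarWandFree A) (t : T) :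
    Sat (fun s => V (f s)) A t ↔ S4Sat R V A (f t) := by
  induction A generalizing t with
  | atom p => rfl
  | neg A ih => exact not_congr (ih hA t)
  | conj A B ihA ihB => exact and_congr (ihA hA.1 t) (ihB hA.2 t)
  | box A ih =>
    constructor
    · intro h v hv
      obtain ⟨s, hs, rfl⟩ := back t v hv
      exact (ih hA s).1 (h s hs)
    · intro h s hs
      exact (ih hA s).2 (h _ (forth t s hs))
  | star => exact hA.elim
  | wand => exact hA.elim

/-- The finite `R`-ascending paths starting at `w₀`, listed from the last world visited to the
first, with the starting world `w₀` omitted. -/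
def Unravelling {W : Type} (R : W → W → Prop) (w₀ : W) : Type :=
  {l : List W // (l ++ [w₀]).Pairwise fun a b => R b a}

namespace Unravelling

variable {W : Type} {R : W → W → Prop} {w₀ : W}

/-- Paths are ordered by extension. -/
instance : PartialOrder (Unravelling R w₀) where
  le s t := s.1 <:+ t.1
  le_refl s := List.suffix_refl s.1
  le_trans _ _ _ h h' := List.IsSuffix.trans h h'
  le_antisymm _ _ h h' := Subtype.ext (h.eq_of_length_le h'.length_le)

/-- The path that stays at `w₀`. -/
def root (R : W → W → Prop) (w₀ : W) : Unravelling R w₀ := ⟨[], by simp⟩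

/-- The last world visited by a path. -/
def endpoint (s : Unravelling R w₀) : W := s.1.headD w₀

theorem root_le (s : Unravelling R w₀) : root R w₀ ≤ s := List.nil_suffix

theorem le_total_of_le {s t u : Unravelling R w₀} (hs : s ≤ u) (ht : t ≤ u) : s ≤ t ∨ t ≤ s :=
  List.suffix_or_suffix_of_suffix hs ht

theorem rel_endpoint_of_le (hR : Reflexive R) {s t : Unravelling R w₀} (h : s ≤ t) :
    R s.endpoint t.endpoint := by
  obtain ⟨l, hl⟩ := s
  obtain ⟨l', hl'⟩ := t
  obtain ⟨p, rfl : p ++ l = l'⟩ := h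
  cases p with
  | nil => exact hR _
  | cons x p =>
    refine List.rel_of_pairwise_cons hl' ?_
    cases l <;> simp [endpoint]

theorem exists_endpoint_eq (hR : Reflexive R) (hT : Transitive R) (s : Unravelling R w₀) {v : W}
    (h : R s.endpoint v) : ∃ t, s ≤ t ∧ t.endpoint = v := by
  obtain ⟨l, hl⟩ := s
  refine ⟨⟨v :: l, List.pairwise_cons.2 ⟨fun y hy => ?_, hl⟩⟩, List.suffix_cons v l, rfl⟩
  refine hT ?_ h
  cases l with
  | nil =>
    obtain rfl : y = w₀ := by simpa using hy
    exact hR _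
  | cons x l =>
    rcases List.mem_cons.1 hy with rfl | hy
    · exact hR _
    · exact List.rel_of_pairwise_cons hl hy

/-- The BL model on the unravelling with the valuation read off at endpoints. -/
def model (R : W → W → Prop) (w₀ : W) (V : W → ℕ → Prop) : BLModel (Unravelling R w₀) where
  rooted := ⟨root R w₀, root_le⟩
  persist _ _ _ h hle :=
    ⟨fun h' => h.1 (hle.trans h'), fun h' => (le_total_of_le hle h').elim h.1 h.2⟩
  V s := V s.endpoint

end Unravelling

/-- BL is a conservative extension of S4: a ∗/—∗-free formula is BL-valid
iff it is S4-valid. -/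
theorem BL_conservative_over_S4 (A : BLForm) (hA : StarWandFree A) :
    BLValid A ↔ S4Valid A := by
  constructor
  · intro h W R hR hT V w
    exact (sat_iff_s4Sat Unravelling.endpoint (fun _ _ => Unravelling.rel_endpoint_of_le hR)
      (fun s _ => s.exists_endpoint_eq hR hT) A hA (Unravelling.root R w)).1
      (h _ (Unravelling.model R w V) _)
  · intro h W _ M w
    exact (sat_iff_s4Sat id (fun _ _ => id) (fun _ v hv => ⟨v, hv, rfl⟩) A hA w).2
      (h W (· ≤ ·) le_refl (fun _ _ _ => le_trans) M.V w)
end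

section
/- For all BL formulas A and B, the formula (◇A ∗ B) ↔ (A ∗ B) is valid in BL (i.e., over rooted partial orders with the persistent separation property). -/
/-- Biconditional is interpreted classically. -/
theorem sat_iff {W : Type} [PartialOrder W] (V : W → ℕ → Prop) (A B : BLForm) (w : W) :
    Sat V (A.iff B) w ↔ (Sat V A w ↔ Sat V B w) := by
  simp only [BLForm.iff, BLForm.imp, BLForm.or, Sat]
  tauto

theorem sat_dia {W : Type} [PartialOrder W] (V : W → ℕ → Prop) (A : BLForm) (w : W) :
    Sat V A.dia w ↔ ∃ w', w ≤ w' ∧ Sat V A w' := by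
  simp [BLForm.dia, Sat]

/-- For all BL formulas `A`, `B`, the formula `(◇A ∗ B) ↔ (A ∗ B)` is valid in BL
(i.e. over rooted partial orders with the persistent separation property). -/
theorem diaStar_iff_star (A B : BLForm) :
    BLValid (((A.dia).star B).iff (A.star B)) := by
  intro W _ M w
  rw [sat_iff]
  constructor
  · rintro ⟨w1, w2, ⟨h1, h2, hsep⟩, hA, hB⟩
    obtain ⟨w1', hle, hA'⟩ := (sat_dia M.V A w1).1 hA
    exact ⟨w1', w2, ⟨h1.trans hle, h2, M.persist w1 w2 w1' hsep hle⟩, hA', hB⟩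
  · rintro ⟨w1, w2, hrel, hA, hB⟩
    exact ⟨w1, w2, hrel, (sat_dia M.V A w1).2 ⟨w1, le_rfl, hA⟩, hB⟩
end

section
/- The formula (◇p ∗ q) ↔ (p ∗ q) is not valid in lax BL: for distinct propositional letters p and q there exist a rooted partial order (W, ≤) (not required to satisfy the persistent separation property), a valuation V, and a world x such that, with satisfaction defined by the BL clauses over the bifurcation relation Rel(w, w1, w2) ⟺ w ≤ w1 ∧ w ≤ w2 ∧ w1 # w2, one has x ⊩ ◇p ∗ q but x ⊮ p ∗ q. -/
/-- `(◇p ∗ q) ↔ (p ∗ q)` is not valid in lax BL: for distinct propositional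
letters `p`, `q` there is a rooted partial order (not required to satisfy the
persistent separation property), a valuation, and a world `x` such that
`x ⊩ ◇p ∗ q` but `x ⊮ p ∗ q`. -/
theorem diaStar_not_valid_in_lax_BL (p q : ℕ) (hpq : p ≠ q) :
    ∃ (W : Type) (inst : PartialOrder W) (V : W → ℕ → Prop) (x : W),
      @Rooted W inst ∧
      @Sat W inst V (BLForm.star (BLForm.dia (BLForm.atom p)) (BLForm.atom q)) x ∧
      ¬ @Sat W inst V (BLForm.star (BLForm.atom p) (BLForm.atom q)) x := by
  refine ⟨Bool × Bool, inferInstance,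
    fun w n => (n = p ∧ w = (true, true)) ∨ (n = q ∧ w = (false, true)), (false, false),
    ⟨(false, false), by decide⟩,
    ⟨(true, false), (false, true), ⟨by decide, by decide, by decide, by decide⟩, ?_, ?_⟩, ?_⟩
  · exact fun h => h (true, true) (by decide) (Or.inl ⟨rfl, rfl⟩)
  · exact Or.inr ⟨rfl, rfl⟩
  · rintro ⟨w1, w2, ⟨-, -, -, hsep⟩, ⟨-, rfl⟩ | ⟨h, -⟩, -⟩
    · exact hsep le_top
    · exact hpq h
end

section
/- Soundness of TBL: if a BL formula A is provable in the labelled tableaux calculus TBL (i.e., some tableau with root F A:x is closed), then A is valid in BL (true at every world of every BL model). -/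
/-- Signed labelled formulas (`T A:x`, `F A:x`) and signed label constraints
(`T x ≤ y`, `F x ≤ y`); labels are identified with `ℕ`. -/
inductive SEntry : Type
  | Tf : BLForm → ℕ → SEntry
  | Ff : BLForm → ℕ → SEntry
  | Tle : ℕ → ℕ → SEntry
  | Fle : ℕ → ℕ → SEntry

/-- A tableau branch: a set of signed labelled formulas and constraints. -/
abbrev Branch := Set SEntry

/-- The domain of a branch: the labels occurring in it (i.e. labelling its
signed formulas). -/
def domB (b : Branch) : Set ℕ :=
  { x | ∃ A : BLForm, SEntry.Tf A x ∈ b ∨ SEntry.Ff A x ∈ b }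

/-- `T x # y` holds in a branch: both `F x ≤ y` and `F y ≤ x` belong to it. -/
def SepIn (b : Branch) (x y : ℕ) : Prop :=
  SEntry.Fle x y ∈ b ∧ SEntry.Fle y x ∈ b

/-- `T Bif(x,y,z)` holds in a branch: `T x ≤ y`, `T x ≤ z`, `T y # z`. -/
def BifIn (b : Branch) (x y z : ℕ) : Prop :=
  SEntry.Tle x y ∈ b ∧ SEntry.Tle x z ∈ b ∧ SepIn b y z

/-- A branch is closed if it contains a contradictory pair `T A:x` / `F A:x`
or `T x ≤ y` / `F x ≤ y`. -/
def ClosedBranch (b : Branch) : Prop :=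
  (∃ (A : BLForm) (x : ℕ), SEntry.Tf A x ∈ b ∧ SEntry.Ff A x ∈ b) ∨
  (∃ x y : ℕ, SEntry.Tle x y ∈ b ∧ SEntry.Fle x y ∈ b)

/-- A branch is open if it is not closed. -/
def OpenBranch (b : Branch) : Prop := ¬ ClosedBranch b

/-- A realization of a branch in a BL model: an assignment of worlds to labels
respecting all signed formulas and constraints of the branch. -/
def Realizes {W : Type} [PartialOrder W] (M : BLModel W) (ρ : ℕ → W)
    (b : Branch) : Prop :=
  (∀ (A : BLForm) (x : ℕ), SEntry.Tf A x ∈ b → Sat M.V A (ρ x)) ∧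
  (∀ (A : BLForm) (x : ℕ), SEntry.Ff A x ∈ b → ¬ Sat M.V A (ρ x)) ∧
  (∀ x y : ℕ, SEntry.Tle x y ∈ b → ρ x ≤ ρ y) ∧
  (∀ x y : ℕ, SEntry.Fle x y ∈ b → ¬ ρ x ≤ ρ y)

/-- A branch is realizable if it has a realization in some BL model. -/
def Realizable (b : Branch) : Prop :=
  ∃ (W : Type) (inst : PartialOrder W) (M : @BLModel W inst) (ρ : ℕ → W),
    @Realizes W inst M ρ b

/-- The additional entries for `T Bif(x,y,z)`:
`T x ≤ y`, `T x ≤ z`, `F y ≤ z`, `F z ≤ y`. -/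
def bifSet (x y z : ℕ) : Set SEntry :=
  {SEntry.Tle x y, SEntry.Tle x z, SEntry.Fle y z, SEntry.Fle z y}

/-- The TBL expansion rules: `Expands b bs` means that expanding the branch `b`
by one application of a rule produces the branches `bs`. -/
inductive Expands : Branch → List Branch → Prop
  /-- from `T ¬A:x` add `F A:x` -/
  | Tnot (b : Branch) (A : BLForm) (x : ℕ) (h : SEntry.Tf (.neg A) x ∈ b) :
      Expands b [insert (SEntry.Ff A x) b]
  /-- from `F ¬A:x` add `T A:x` -/
  | Fnot (b : Branch) (A : BLForm) (x : ℕ) (h : SEntry.Ff (.neg A) x ∈ b) :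
      Expands b [insert (SEntry.Tf A x) b]
  /-- from `T A∧B:x` add `T A:x`, `T B:x` -/
  | Tand (b : Branch) (A B : BLForm) (x : ℕ) (h : SEntry.Tf (.conj A B) x ∈ b) :
      Expands b [b ∪ {SEntry.Tf A x, SEntry.Tf B x}]
  /-- from `F A∧B:x` branch into `F A:x` | `F B:x` -/
  | Fand (b : Branch) (A B : BLForm) (x : ℕ) (h : SEntry.Ff (.conj A B) x ∈ b) :
      Expands b [insert (SEntry.Ff A x) b, insert (SEntry.Ff B x) b]
  /-- from `F ◻A:x` add `T x ≤ u`, `F A:u` with `u` fresh -/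
  | Fbox (b : Branch) (A : BLForm) (x u : ℕ) (h : SEntry.Ff (.box A) x ∈ b)
      (hu : u ∉ domB b) :
      Expands b [b ∪ {SEntry.Tle x u, SEntry.Ff A u}]
  /-- from `T ◻A:x` and `T x ≤ y` add `T A:y` -/
  | Tbox (b : Branch) (A : BLForm) (x y : ℕ) (h1 : SEntry.Tf (.box A) x ∈ b)
      (h2 : SEntry.Tle x y ∈ b) :
      Expands b [insert (SEntry.Tf A y) b]
  /-- from `T A∗B:x` add `T Bif(x,u,v)`, `T A:u`, `T B:v` with `u`, `v` fresh and distinct -/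
  | Tstar (b : Branch) (A B : BLForm) (x u v : ℕ) (h : SEntry.Tf (.star A B) x ∈ b)
      (hu : u ∉ domB b) (hv : v ∉ domB b) (huv : u ≠ v) :
      Expands b [b ∪ bifSet x u v ∪ {SEntry.Tf A u, SEntry.Tf B v}]
  /-- from `F A∗B:x` and `T Bif(x,y,z)` branch into `F A:y` | `F B:z` -/
  | Fstar (b : Branch) (A B : BLForm) (x y z : ℕ) (h : SEntry.Ff (.star A B) x ∈ b)
      (hb : BifIn b x y z) :
      Expands b [insert (SEntry.Ff A y) b, insert (SEntry.Ff B z) b]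
  /-- from `T A—∗B:x` and `T Bif(z,x,y)` branch into `F A:y` | `T B:z` -/
  | Twand (b : Branch) (A B : BLForm) (x y z : ℕ) (h : SEntry.Tf (.wand A B) x ∈ b)
      (hb : BifIn b z x y) :
      Expands b [insert (SEntry.Ff A y) b, insert (SEntry.Tf B z) b]
  /-- from `F A—∗B:x` add `T Bif(v,x,u)`, `T A:u`, `F B:v` with `u`, `v` fresh and distinct -/
  | Fwand (b : Branch) (A B : BLForm) (x u v : ℕ) (h : SEntry.Ff (.wand A B) x ∈ b)
      (hu : u ∉ domB b) (hv : v ∉ domB b) (huv : u ≠ v) :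
      Expands b [b ∪ bifSet v x u ∪ {SEntry.Tf A u, SEntry.Ff B v}]
  /-- from `T A:x`, `T x ≤ y`, `T y ≤ x` add `T A:y` -/
  | EquT (b : Branch) (A : BLForm) (x y : ℕ) (h : SEntry.Tf A x ∈ b)
      (h1 : SEntry.Tle x y ∈ b) (h2 : SEntry.Tle y x ∈ b) :
      Expands b [insert (SEntry.Tf A y) b]
  /-- from `F A:x`, `T x ≤ y`, `T y ≤ x` add `F A:y` -/
  | EquF (b : Branch) (A : BLForm) (x y : ℕ) (h : SEntry.Ff A x ∈ b)
      (h1 : SEntry.Tle x y ∈ b) (h2 : SEntry.Tle y x ∈ b) :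
      Expands b [insert (SEntry.Ff A y) b]
  /-- from `S A:x` and `S' B:y` branch into `T x ≤ y` | `T y ≤ x` | `T x # y` -/
  | CaseD (b : Branch) (x y : ℕ) (hx : x ∈ domB b) (hy : y ∈ domB b) :
      Expands b [insert (SEntry.Tle x y) b, insert (SEntry.Tle y x) b,
                 b ∪ {SEntry.Fle x y, SEntry.Fle y x}]
  /-- from `S A:x` add `T x ≤ x` -/
  | Refl (b : Branch) (x : ℕ) (hx : x ∈ domB b) :
      Expands b [insert (SEntry.Tle x x) b]
  /-- from `T x ≤ y`, `T y ≤ z` add `T x ≤ z` -/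
  | Tran (b : Branch) (x y z : ℕ) (h1 : SEntry.Tle x y ∈ b)
      (h2 : SEntry.Tle y z ∈ b) :
      Expands b [insert (SEntry.Tle x z) b]
  /-- from `T x1 # x2` and `T x1 ≤ y` add `T x2 # y` (the case `i = 2` is the
  instance with `x1` and `x2` interchanged) -/
  | SepP (b : Branch) (x1 x2 y : ℕ) (h1 : SEntry.Fle x1 x2 ∈ b)
      (h2 : SEntry.Fle x2 x1 ∈ b) (h3 : SEntry.Tle x1 y ∈ b) :
      Expands b [b ∪ {SEntry.Fle x2 y, SEntry.Fle y x2}]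

/-- A tableau, presented as the list of its branches; it is realizable if at
least one branch is realizable. -/
def TabRealizable (T : List Branch) : Prop := ∃ b ∈ T, Realizable b

/-- One expansion step on a tableau: replace one branch by the result of
applying one expansion rule to it. -/
inductive TabStep : List Branch → List Branch → Prop
  | step (pre post : List Branch) (b : Branch) (bs : List Branch)
      (h : Expands b bs) : TabStep (pre ++ b :: post) (pre ++ (bs ++ post))

/-- A tableau is closed if all of its branches are closed. -/
def ClosedTab (T : List Branch) : Prop := ∀ b ∈ T, ClosedBranch b

/-- `⊢TBL A`: some tableau with root `F A:x` (built by the expansion rules)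
is closed. -/
def TBLProvable (A : BLForm) : Prop :=
  ∃ (x : ℕ) (T : List Branch),
    Relation.ReflTransGen TabStep [{SEntry.Ff A x}] T ∧ ClosedTab T

/-- The labels occurring in a signed formula or constraint. -/
def SEntry.labels : SEntry → Set ℕ
  | .Tf _ x => {x}
  | .Ff _ x => {x}
  | .Tle x y => {x, y}
  | .Fle x y => {x, y}

/-- A signed entry is true under an assignment of worlds to labels. -/
def SEntry.Holds {W : Type} [PartialOrder W] (M : BLModel W) (ρ : ℕ → W) : SEntry → Prop
  | .Tf A x => Sat M.V A (ρ x)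
  | .Ff A x => ¬ Sat M.V A (ρ x)
  | .Tle x y => ρ x ≤ ρ y
  | .Fle x y => ¬ ρ x ≤ ρ y

/-- Every label of a branch, including those of its constraints, labels a signed formula. -/
def Branch.LabelsInDom (b : Branch) : Prop := ∀ e ∈ b, e.labels ⊆ domB b

theorem domB_mono {b b' : Branch} (h : b ⊆ b') : domB b ⊆ domB b' :=
  fun _ ⟨A, hA⟩ => ⟨A, hA.imp (@h _) (@h _)⟩

theorem mem_domB_of_Tf {b : Branch} {A : BLForm} {x : ℕ} (h : SEntry.Tf A x ∈ b) :
    x ∈ domB b := ⟨A, Or.inl h⟩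

theorem mem_domB_of_Ff {b : Branch} {A : BLForm} {x : ℕ} (h : SEntry.Ff A x ∈ b) :
    x ∈ domB b := ⟨A, Or.inr h⟩

theorem SEntry.Holds.congr {W : Type} [PartialOrder W] {M : BLModel W} {ρ ρ' : ℕ → W}
    {e : SEntry} (he : e.Holds M ρ) (h : ∀ x ∈ e.labels, ρ' x = ρ x) : e.Holds M ρ' := by
  cases e <;> simp_all [SEntry.Holds, SEntry.labels]

theorem Branch.LabelsInDom.union {b c : Branch} (hb : b.LabelsInDom)
    (hc : ∀ e ∈ c, e.labels ⊆ domB (b ∪ c)) : Branch.LabelsInDom (b ∪ c) := by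
  rintro e (he | he)
  · exact (hb e he).trans (domB_mono Set.subset_union_left)
  · exact hc e he

theorem Branch.LabelsInDom.insert_entry {b : Branch} {e : SEntry} (hb : b.LabelsInDom)
    (he : e.labels ⊆ domB (insert e b)) : Branch.LabelsInDom (insert e b) := by
  rintro e' (rfl | he')
  · exact he
  · exact (hb e' he').trans (domB_mono (Set.subset_insert _ _))

theorem Branch.LabelsInDom.of_Tle {b : Branch} (hb : b.LabelsInDom) {x y : ℕ}
    (h : SEntry.Tle x y ∈ b) : x ∈ domB b ∧ y ∈ domB b :=
  ⟨hb _ h (Set.mem_insert _ _), hb _ h (Set.mem_insert_of_mem _ rfl)⟩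

theorem Branch.LabelsInDom.of_Fle {b : Branch} (hb : b.LabelsInDom) {x y : ℕ}
    (h : SEntry.Fle x y ∈ b) : x ∈ domB b ∧ y ∈ domB b :=
  ⟨hb _ h (Set.mem_insert _ _), hb _ h (Set.mem_insert_of_mem _ rfl)⟩

theorem Branch.LabelsInDom.insert_Tf {b : Branch} (hb : b.LabelsInDom) (A : BLForm) (x : ℕ) :
    Branch.LabelsInDom (insert (SEntry.Tf A x) b) :=
  hb.insert_entry (Set.singleton_subset_iff.2 (mem_domB_of_Tf (Set.mem_insert _ _)))

theorem Branch.LabelsInDom.insert_Ff {b : Branch} (hb : b.LabelsInDom) (A : BLForm) (x : ℕ) :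
    Branch.LabelsInDom (insert (SEntry.Ff A x) b) :=
  hb.insert_entry (Set.singleton_subset_iff.2 (mem_domB_of_Ff (Set.mem_insert _ _)))

theorem Branch.LabelsInDom.insert_Tle {b : Branch} (hb : b.LabelsInDom) {x y : ℕ}
    (hx : x ∈ domB b) (hy : y ∈ domB b) : Branch.LabelsInDom (insert (SEntry.Tle x y) b) :=
  hb.insert_entry (Set.Subset.trans (Set.insert_subset hx (Set.singleton_subset_iff.2 hy))
    (domB_mono (Set.subset_insert _ _)))

theorem Branch.LabelsInDom.union_sep {b : Branch} (hb : b.LabelsInDom) {x y : ℕ}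
    (hx : x ∈ domB b) (hy : y ∈ domB b) :
    Branch.LabelsInDom (b ∪ {SEntry.Fle x y, SEntry.Fle y x}) := by
  have hx' := domB_mono (Set.subset_union_left (t := {SEntry.Fle x y, SEntry.Fle y x})) hx
  have hy' := domB_mono (Set.subset_union_left (t := {SEntry.Fle x y, SEntry.Fle y x})) hy
  refine hb.union ?_
  rintro e (rfl | rfl)
  · exact Set.insert_subset hx' (Set.singleton_subset_iff.2 hy')
  · exact Set.insert_subset hy' (Set.singleton_subset_iff.2 hx')

theorem Branch.LabelsInDom.union_bifSet {b c : Branch} {x y z : ℕ} (hb : b.LabelsInDom)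
    (hc : c.LabelsInDom) (hx : x ∈ domB b ∪ domB c) (hy : y ∈ domB b ∪ domB c)
    (hz : z ∈ domB b ∪ domB c) : Branch.LabelsInDom (b ∪ bifSet x y z ∪ c) := by
  have hsub : domB b ∪ domB c ⊆ domB (b ∪ bifSet x y z ∪ c) :=
    Set.union_subset (domB_mono fun _ h => Or.inl (Or.inl h)) (domB_mono fun _ h => Or.inr h)
  rintro e ((he | he) | he)
  · exact (hb e he).trans (Set.subset_union_left.trans hsub)
  · refine Set.Subset.trans ?_ hsub
    rcases he with rfl | rfl | rfl | rfl <;>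
      simp only [SEntry.labels, Set.insert_subset_iff, Set.singleton_subset_iff] <;>
      exact ⟨by assumption, by assumption⟩
  · exact (hc e he).trans (Set.subset_union_right.trans hsub)

/-- Every expansion rule keeps the labels of constraints inside the domain of the branch. -/
theorem Expands.labelsInDom {b : Branch} {bs : List Branch} (h : Expands b bs)
    (hb : b.LabelsInDom) : ∀ b' ∈ bs, Branch.LabelsInDom b' := by
  cases h with
  | Tnot A x h => simpa using hb.insert_Ff A x
  | Fnot A x h => simpa using hb.insert_Tf A x
  | Tand A B x h =>
    simp only [List.mem_singleton, forall_eq]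
    refine hb.union ?_
    rintro e (rfl | rfl)
    · exact Set.singleton_subset_iff.2 (mem_domB_of_Tf (A := A) (Or.inr (by simp)))
    · exact Set.singleton_subset_iff.2 (mem_domB_of_Tf (A := B) (Or.inr (by simp)))
  | Fand A B x h => simpa using ⟨hb.insert_Ff A x, hb.insert_Ff B x⟩
  | Fbox A x u h hu =>
    simp only [List.mem_singleton, forall_eq]
    have hu' : u ∈ domB (b ∪ {SEntry.Tle x u, SEntry.Ff A u}) :=
      mem_domB_of_Ff (A := A) (Or.inr (by simp))
    refine hb.union ?_
    rintro e (rfl | rfl)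
    · exact Set.insert_subset (mem_domB_of_Ff (Or.inl h)) (Set.singleton_subset_iff.2 hu')
    · exact Set.singleton_subset_iff.2 hu'
  | Tbox A x y h1 h2 => simpa using hb.insert_Tf A y
  | Tstar A B x u v h hu hv huv =>
    simp only [List.mem_singleton, forall_eq]
    have hu' : u ∈ domB {SEntry.Tf A u, SEntry.Tf B v} := mem_domB_of_Tf (A := A) (by simp)
    have hv' : v ∈ domB {SEntry.Tf A u, SEntry.Tf B v} := mem_domB_of_Tf (A := B) (by simp)
    refine hb.union_bifSet ?_ (Or.inl (mem_domB_of_Tf h)) (Or.inr hu') (Or.inr hv')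
    rintro e (rfl | rfl)
    exacts [Set.singleton_subset_iff.2 hu', Set.singleton_subset_iff.2 hv']
  | Fstar A B x y z h h' => simpa using ⟨hb.insert_Ff A y, hb.insert_Ff B z⟩
  | Twand A B x y z h h' => simpa using ⟨hb.insert_Ff A y, hb.insert_Tf B z⟩
  | Fwand A B x u v h hu hv huv =>
    simp only [List.mem_singleton, forall_eq]
    have hu' : u ∈ domB {SEntry.Tf A u, SEntry.Ff B v} := mem_domB_of_Tf (A := A) (by simp)
    have hv' : v ∈ domB {SEntry.Tf A u, SEntry.Ff B v} := mem_domB_of_Ff (A := B) (by simp)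
    refine hb.union_bifSet ?_ (Or.inr hv') (Or.inl (mem_domB_of_Ff h)) (Or.inr hu')
    rintro e (rfl | rfl)
    exacts [Set.singleton_subset_iff.2 hu', Set.singleton_subset_iff.2 hv']
  | EquT A x y h h1 h2 => simpa using hb.insert_Tf A y
  | EquF A x y h h1 h2 => simpa using hb.insert_Ff A y
  | CaseD x y hx hy =>
    simp only [List.mem_cons, List.not_mem_nil, or_false, forall_eq_or_imp, forall_eq]
    exact ⟨hb.insert_Tle hx hy, hb.insert_Tle hy hx, hb.union_sep hx hy⟩
  | Refl x hx => simpa using hb.insert_Tle hx hx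
  | Tran x y z h1 h2 => simpa using hb.insert_Tle (hb.of_Tle h1).1 (hb.of_Tle h2).2
  | SepP x1 x2 y h1 h2 h3 => simpa using hb.union_sep (hb.of_Fle h1).2 (hb.of_Tle h3).2

section Realization

variable {W : Type} [PartialOrder W] {M : BLModel W} {ρ : ℕ → W} {b : Branch}

theorem realizes_iff : Realizes M ρ b ↔ ∀ e ∈ b, e.Holds M ρ := by
  constructor
  · rintro ⟨h1, h2, h3, h4⟩ (⟨A, x⟩ | ⟨A, x⟩ | ⟨x, y⟩ | ⟨x, y⟩) he
    exacts [h1 A x he, h2 A x he, h3 x y he, h4 x y he]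
  · exact fun h => ⟨fun _ _ => h _, fun _ _ => h _, fun _ _ => h _, fun _ _ => h _⟩

theorem Realizes.union {c : Branch} (h : Realizes M ρ b) (hc : ∀ e ∈ c, e.Holds M ρ) :
    Realizes M ρ (b ∪ c) :=
  realizes_iff.2 fun e he => he.elim (realizes_iff.1 h e) (hc e)

theorem Realizes.insert {e : SEntry} (h : Realizes M ρ b) (he : e.Holds M ρ) :
    Realizes M ρ (insert e b) :=
  realizes_iff.2 fun e' he' => he'.elim (fun h' => h' ▸ he) (realizes_iff.1 h e')

theorem Realizes.congr {ρ' : ℕ → W} (h : Realizes M ρ b) (hb : b.LabelsInDom)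
    (hρ : ∀ x ∈ domB b, ρ' x = ρ x) : Realizes M ρ' b :=
  realizes_iff.2 fun e he => (realizes_iff.1 h e he).congr fun x hx => hρ x (hb e he hx)

theorem Realizes.not_closedBranch (h : Realizes M ρ b) : ¬ ClosedBranch b := by
  obtain ⟨h1, h2, h3, h4⟩ := h
  rintro (⟨A, x, hT, hF⟩ | ⟨x, y, hT, hF⟩)
  exacts [h2 A x hF (h1 A x hT), h4 x y hF (h3 x y hT)]

theorem Realizes.bifRel {x y z : ℕ} (h : Realizes M ρ b) (hbif : BifIn b x y z) :
    BifRel (ρ x) (ρ y) (ρ z) :=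
  ⟨h.2.2.1 _ _ hbif.1, h.2.2.1 _ _ hbif.2.1, h.2.2.2 _ _ hbif.2.2.1, h.2.2.2 _ _ hbif.2.2.2⟩

theorem holds_of_mem_bifSet {x y z : ℕ} (h : BifRel (ρ x) (ρ y) (ρ z)) :
    ∀ e ∈ bifSet x y z, e.Holds M ρ := by
  rintro e (rfl | rfl | rfl | rfl)
  exacts [h.1, h.2.1, h.2.2.1, h.2.2.2]

theorem Realizes.exists_two_fresh {u v : ℕ} (h : Realizes M ρ b) (hb : b.LabelsInDom)
    (hu : u ∉ domB b) (hv : v ∉ domB b) (huv : u ≠ v) (w₁ w₂ : W) :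
    ∃ ρ' : ℕ → W, Realizes M ρ' b ∧ (∀ x ∈ domB b, ρ' x = ρ x) ∧ ρ' u = w₁ ∧ ρ' v = w₂ := by
  have hρ : ∀ x ∈ domB b, Function.update (Function.update ρ u w₁) v w₂ x = ρ x := fun x hx => by
    rw [Function.update_of_ne (ne_of_mem_of_not_mem hx hv),
      Function.update_of_ne (ne_of_mem_of_not_mem hx hu)]
  exact ⟨_, h.congr hb hρ, hρ, by simp [huv], by simp⟩

/-- Every expansion rule preserves realizability in a fixed model. -/
theorem Expands.exists_realizes {bs : List Branch} (h : Expands b bs) (hb : b.LabelsInDom)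
    (hr : Realizes M ρ b) : ∃ b' ∈ bs, ∃ ρ' : ℕ → W, Realizes M ρ' b' := by
  have ⟨hT, hF, hle, hnle⟩ := hr
  cases h with
  | Tnot A x h => exact ⟨_, by simp, ρ, hr.insert (e := .Ff A x) (hT _ _ h)⟩
  | Fnot A x h => exact ⟨_, by simp, ρ, hr.insert (e := .Tf A x) (not_not.1 (hF _ _ h))⟩
  | Tand A B x h =>
    refine ⟨_, List.mem_singleton_self _, ρ, hr.union ?_⟩
    rintro e (rfl | rfl)
    exacts [(hT _ _ h).1, (hT _ _ h).2]
  | Fand A B x h =>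
    rcases not_and_or.1 (hF _ _ h) with hA | hB
    · exact ⟨_, by simp, ρ, hr.insert (e := .Ff A x) hA⟩
    · exact ⟨_, by simp, ρ, hr.insert (e := .Ff B x) hB⟩
  | Fbox A x u h hu =>
    have hbox := hF _ _ h
    simp only [Sat, not_forall] at hbox
    obtain ⟨w, hw, hA⟩ := hbox
    have hρ : ∀ y ∈ domB b, Function.update ρ u w y = ρ y := fun y hy =>
      Function.update_of_ne (ne_of_mem_of_not_mem hy hu) _ _
    refine ⟨_, List.mem_singleton_self _, Function.update ρ u w, (hr.congr hb hρ).union ?_⟩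
    rintro e (rfl | rfl)
    · simpa [SEntry.Holds, hρ x (mem_domB_of_Ff h)] using hw
    · simpa [SEntry.Holds] using hA
  | Tbox A x y h1 h2 => exact ⟨_, by simp, ρ, hr.insert (e := .Tf A y) (hT _ _ h1 _ (hle _ _ h2))⟩
  | Tstar A B x u v h hu hv huv =>
    obtain ⟨w₁, w₂, hbif, hA, hB⟩ := hT _ _ h
    obtain ⟨ρ', hr', hρ, rfl, rfl⟩ := hr.exists_two_fresh hb hu hv huv w₁ w₂
    rw [← hρ x (mem_domB_of_Tf h)] at hbif
    refine ⟨_, List.mem_singleton_self _, ρ', (hr'.union (holds_of_mem_bifSet hbif)).union ?_⟩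
    rintro e (rfl | rfl)
    exacts [hA, hB]
  | Fstar A B x y z h h' =>
    by_cases hA : Sat M.V A (ρ y)
    · exact ⟨_, by simp, ρ, hr.insert (e := .Ff B z)
        fun hB => hF _ _ h ⟨_, _, hr.bifRel h', hA, hB⟩⟩
    · exact ⟨_, by simp, ρ, hr.insert (e := .Ff A y) hA⟩
  | Twand A B x y z h h' =>
    by_cases hA : Sat M.V A (ρ y)
    · exact ⟨_, by simp, ρ, hr.insert (e := .Tf B z) (hT _ _ h _ _ (hr.bifRel h') hA)⟩
    · exact ⟨_, by simp, ρ, hr.insert (e := .Ff A y) hA⟩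
  | Fwand A B x u v h hu hv huv =>
    have hwand := hF _ _ h
    simp only [Sat, not_forall] at hwand
    obtain ⟨w₁, w₂, hbif, hA, hB⟩ := hwand
    obtain ⟨ρ', hr', hρ, rfl, rfl⟩ := hr.exists_two_fresh hb hu hv huv w₁ w₂
    rw [← hρ x (mem_domB_of_Ff h)] at hbif
    refine ⟨_, List.mem_singleton_self _, ρ', (hr'.union (holds_of_mem_bifSet hbif)).union ?_⟩
    rintro e (rfl | rfl)
    exacts [hA, hB]
  | EquT A x y h h1 h2 =>
    refine ⟨_, List.mem_singleton_self _, ρ, hr.insert ?_⟩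
    simpa only [SEntry.Holds, le_antisymm (hle _ _ h1) (hle _ _ h2)] using hT _ _ h
  | EquF A x y h h1 h2 =>
    refine ⟨_, List.mem_singleton_self _, ρ, hr.insert ?_⟩
    simpa only [SEntry.Holds, le_antisymm (hle _ _ h1) (hle _ _ h2)] using hF _ _ h
  | CaseD x y hx hy =>
    by_cases h1 : ρ x ≤ ρ y
    · exact ⟨_, by simp, ρ, hr.insert (e := .Tle x y) h1⟩
    by_cases h2 : ρ y ≤ ρ x
    · exact ⟨_, by simp, ρ, hr.insert (e := .Tle y x) h2⟩
    refine ⟨b ∪ {SEntry.Fle x y, SEntry.Fle y x}, by simp, ρ, hr.union ?_⟩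
    rintro e (rfl | rfl)
    exacts [h1, h2]
  | Refl x hx => exact ⟨_, by simp, ρ, hr.insert (e := .Tle x x) le_rfl⟩
  | Tran x y z h1 h2 =>
    exact ⟨_, by simp, ρ, hr.insert (e := .Tle x z) ((hle _ _ h1).trans (hle _ _ h2))⟩
  | SepP x1 x2 y h1 h2 h3 =>
    have hsep := M.persist _ _ _ ⟨hnle _ _ h1, hnle _ _ h2⟩ (hle _ _ h3)
    refine ⟨_, List.mem_singleton_self _, ρ, hr.union ?_⟩
    rintro e (rfl | rfl)
    exacts [hsep.2, hsep.1]

theorem TabStep.exists_realizes {T T' : List Branch} (h : TabStep T T')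
    (hT : ∃ b ∈ T, Branch.LabelsInDom b ∧ ∃ ρ : ℕ → W, Realizes M ρ b) :
    ∃ b ∈ T', Branch.LabelsInDom b ∧ ∃ ρ : ℕ → W, Realizes M ρ b := by
  obtain ⟨pre, post, b, bs, hexp⟩ := h
  obtain ⟨c, hc, hdom, ρ, hr⟩ := hT
  rcases List.mem_append.1 hc with hc | hc
  · exact ⟨c, by simp [hc], hdom, ρ, hr⟩
  rcases List.mem_cons.1 hc with rfl | hc
  · obtain ⟨c', hc', ρ', hr'⟩ := hexp.exists_realizes hdom hr
    exact ⟨c', by simp [hc'], hexp.labelsInDom hdom c' hc', ρ', hr'⟩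
  · exact ⟨c, by simp [hc], hdom, ρ, hr⟩

end Realization

/-- Soundness of TBL: if `A` is provable in the labelled tableaux calculus
(some tableau with root `F A:x` is closed), then `A` is valid in BL. -/
theorem TBL_sound (A : BLForm) (h : TBLProvable A) : BLValid A := by
  intro W _ M w
  by_contra hw
  obtain ⟨x, T, hsteps, hclosed⟩ := h
  have hroot : ∃ b ∈ [({SEntry.Ff A x} : Branch)], Branch.LabelsInDom b ∧
      ∃ ρ : ℕ → W, Realizes M ρ b := by
    refine ⟨_, List.mem_singleton_self _, ?_, fun _ => w, realizes_iff.2 ?_⟩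
    · rintro e rfl
      exact Set.singleton_subset_iff.2 (mem_domB_of_Ff rfl)
    · rintro e rfl
      exact hw
  have hreal : ∃ b ∈ T, Branch.LabelsInDom b ∧ ∃ ρ : ℕ → W, Realizes M ρ b := by
    clear hclosed
    induction hsteps with
    | refl => exact hroot
    | tail _ hstep ih => exact hstep.exists_realizes ih
  obtain ⟨b, hbT, -, ρ, hr⟩ := hreal
  exact hr.not_closedBranch (hclosed b hbT)
end

section
/- Let 𝒷 be a saturated open tableau branch, let ⪯ be the quasi-order on dom(𝒷) given by x ⪯ y iff T x ≤ y ∈ 𝒷, let ∼ be the equivalence relation x ∼ y iff x ⪯ y and y ⪯ x, write [x] for the ∼-class of x, and let W𝒷 be the quotient dom(𝒷)/∼. Then the relation [x] ≤𝒷 [y] iff x ⪯ y is well defined and is a partial order on W𝒷 that satisfies the persistent separation property (if [x] # [y] and [x] ≤𝒷 [z] then [z] # [y], where # denotes incomparability with respect to ≤𝒷). -/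
/-- A saturated branch (Definition 19 of the paper): closed under all the
reflexivity/case-distinction/transitivity/congruence/persistence conditions and
under the decomposition conditions for ¬, ∧, ◻, ∗ and —∗. -/
structure Saturated (b : Branch) : Prop where
  /-- (1) if `S A:x ∈ b` then `T x ≤ x ∈ b` -/
  refl : ∀ x ∈ domB b, SEntry.Tle x x ∈ b
  /-- (2) case distinction: labelled worlds are comparable or separated -/
  caseD : ∀ x ∈ domB b, ∀ y ∈ domB b,
    SEntry.Tle x y ∈ b ∨ SEntry.Tle y x ∈ b ∨ SepIn b x y
  /-- (3) transitivity -/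
  trans : ∀ x y z : ℕ, SEntry.Tle x y ∈ b → SEntry.Tle y z ∈ b → SEntry.Tle x z ∈ b
  /-- (4) congruence for `T`-formulas under `T x = y` -/
  equT : ∀ (A : BLForm) (x y : ℕ), SEntry.Tle x y ∈ b → SEntry.Tle y x ∈ b →
    SEntry.Tf A x ∈ b → SEntry.Tf A y ∈ b
  /-- (4) congruence for `F`-formulas under `T x = y` -/
  equF : ∀ (A : BLForm) (x y : ℕ), SEntry.Tle x y ∈ b → SEntry.Tle y x ∈ b →
    SEntry.Ff A x ∈ b → SEntry.Ff A y ∈ b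
  /-- (5) persistence of separation -/
  sepP : ∀ x y z : ℕ, SepIn b x y → SEntry.Tle x z ∈ b → SepIn b z y
  /-- (6) `T ¬A:x` -/
  tneg : ∀ (A : BLForm) (x : ℕ), SEntry.Tf (.neg A) x ∈ b → SEntry.Ff A x ∈ b
  /-- (7) `F ¬A:x` -/
  fneg : ∀ (A : BLForm) (x : ℕ), SEntry.Ff (.neg A) x ∈ b → SEntry.Tf A x ∈ b
  /-- (8) `T A∧B:x` -/
  tconj : ∀ (A B : BLForm) (x : ℕ), SEntry.Tf (.conj A B) x ∈ b →
    SEntry.Tf A x ∈ b ∧ SEntry.Tf B x ∈ b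
  /-- (9) `F A∧B:x` -/
  fconj : ∀ (A B : BLForm) (x : ℕ), SEntry.Ff (.conj A B) x ∈ b →
    SEntry.Ff A x ∈ b ∨ SEntry.Ff B x ∈ b
  /-- (10) `T ◻A:x` -/
  tbox : ∀ (A : BLForm) (x : ℕ), SEntry.Tf (.box A) x ∈ b →
    ∀ y ∈ domB b, SEntry.Tle x y ∈ b → SEntry.Tf A y ∈ b
  /-- (11) `F ◻A:x` -/
  fbox : ∀ (A : BLForm) (x : ℕ), SEntry.Ff (.box A) x ∈ b →
    ∃ y ∈ domB b, SEntry.Tle x y ∈ b ∧ SEntry.Ff A y ∈ b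
  /-- (12) `T A∗B:x` -/
  tstar : ∀ (A B : BLForm) (x : ℕ), SEntry.Tf (.star A B) x ∈ b →
    ∃ y ∈ domB b, ∃ z ∈ domB b, BifIn b x y z ∧ SEntry.Tf A y ∈ b ∧ SEntry.Tf B z ∈ b
  /-- (13) `F A∗B:x` -/
  fstar : ∀ (A B : BLForm) (x : ℕ), SEntry.Ff (.star A B) x ∈ b →
    ∀ y ∈ domB b, ∀ z ∈ domB b, BifIn b x y z → SEntry.Ff A y ∈ b ∨ SEntry.Ff B z ∈ b
  /-- (14) `T A—∗B:x` -/
  twand : ∀ (A B : BLForm) (x : ℕ), SEntry.Tf (.wand A B) x ∈ b →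
    ∀ y ∈ domB b, ∀ z ∈ domB b, BifIn b z x y → SEntry.Ff A y ∈ b ∨ SEntry.Tf B z ∈ b
  /-- (15) `F A—∗B:x` -/
  fwand : ∀ (A B : BLForm) (x : ℕ), SEntry.Ff (.wand A B) x ∈ b →
    ∃ y ∈ domB b, ∃ z ∈ domB b, BifIn b z x y ∧ SEntry.Tf A y ∈ b ∧ SEntry.Ff B z ∈ b

/-- The relation `x ⪯ y` iff `T x ≤ y ∈ b` on labels. -/
def preB (b : Branch) (x y : ℕ) : Prop := SEntry.Tle x y ∈ b

/-- The equivalence `x ∼ y` iff `x ⪯ y` and `y ⪯ x`. -/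
def equivB (b : Branch) (x y : ℕ) : Prop := preB b x y ∧ preB b y x

/-- For a saturated open branch `b`, the relation `[x] ≤ [y]` iff `x ⪯ y` on the
quotient `dom(b)/∼` is well defined and is a partial order with the persistent
separation property (stated on representatives: well-definedness with respect
to `∼`, reflexivity on `dom(b)`, transitivity, antisymmetry up to `∼`, and
persistence of incomparability). -/
theorem saturated_open_quotient_partial_order (b : Branch) (hsat : Saturated b)
    (hopen : OpenBranch b) :
    -- `≤` on classes is well defined
    (∀ x x' y y' : ℕ, equivB b x x' → equivB b y y' → (preB b x y ↔ preB b x' y')) ∧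
    -- reflexivity on the domain
    (∀ x ∈ domB b, preB b x x) ∧
    -- transitivity
    (∀ x y z : ℕ, preB b x y → preB b y z → preB b x z) ∧
    -- antisymmetry: `[x] ≤ [y]` and `[y] ≤ [x]` imply `[x] = [y]`
    (∀ x y : ℕ, preB b x y → preB b y x → equivB b x y) ∧
    -- persistent separation: if `[x] # [y]` and `[x] ≤ [z]` then `[z] # [y]`
    (∀ x ∈ domB b, ∀ y ∈ domB b, ∀ z ∈ domB b,
      (¬ preB b x y ∧ ¬ preB b y x) → preB b x z →
      (¬ preB b z y ∧ ¬ preB b y z)) := by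
  refine ⟨?_, hsat.refl, hsat.trans, fun _ _ hxy hyx => ⟨hxy, hyx⟩, ?_⟩
  · rintro x x' y y' ⟨hxx', hx'x⟩ ⟨hyy', hy'y⟩
    exact ⟨fun h => hsat.trans _ _ _ hx'x (hsat.trans _ _ _ h hyy'),
      fun h => hsat.trans _ _ _ hxx' (hsat.trans _ _ _ h hy'y)⟩
  · rintro x hx y hy z - ⟨hxy, hyx⟩ hxz
    obtain h | h | hsep := hsat.caseD x hx y hy
    · exact absurd h hxy
    · exact absurd h hyx
    · obtain ⟨hzy, hyz⟩ := hsat.sepP x y z hsep hxz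
      exact ⟨fun h => hopen (Or.inr ⟨z, y, h, hzy⟩), fun h => hopen (Or.inr ⟨y, z, h, hyz⟩)⟩
end

section
/- Model existence (truth lemma): let 𝒷 be a saturated open tableau branch, let (W𝒷, ≤𝒷) be the induced quotient partial order with persistent separation, let Rel be its bifurcation relation (Rel(w,w1,w2) ⟺ w ≤𝒷 w1 ∧ w ≤𝒷 w2 ∧ w1 # w2), and define the valuation V([x]) = { p : T p:x ∈ 𝒷 }. Then the resulting structure M𝒷 is a BL model (after adjoining a root if necessary, or under the assumption that 𝒷 stems from a tableau with a single root label, so that W𝒷 is rooted) and for every formula A and every label x ∈ dom(𝒷): if T A:x ∈ 𝒷 then M𝒷, [x] ⊩ A, and if F A:x ∈ 𝒷 then M𝒷, [x] ⊮ A. -/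
/-- `f` exhibits the worlds of a model as the quotient `dom(b)/∼` induced by a
branch `b`: `f` is onto, the order on worlds is the induced order
(`f x ≤ f y` iff `T x ≤ y ∈ b`), and the valuation is
`V([x]) = { p : T p:x ∈ b }`. -/
def InducedModelOn {W : Type} [PartialOrder W] (M : BLModel W) (f : ℕ → W)
    (b : Branch) : Prop :=
  (∀ w : W, ∃ x ∈ domB b, f x = w) ∧
  (∀ x ∈ domB b, ∀ y ∈ domB b, (f x ≤ f y ↔ SEntry.Tle x y ∈ b)) ∧
  (∀ x ∈ domB b, ∀ p : ℕ, (M.V (f x) p ↔ SEntry.Tf (.atom p) x ∈ b))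

theorem sepIn_iff {b : Branch} (hsat : Saturated b) (hopen : OpenBranch b) {x y : ℕ}
    (hx : x ∈ domB b) (hy : y ∈ domB b) :
    SepIn b x y ↔ SEntry.Tle x y ∉ b ∧ SEntry.Tle y x ∉ b := by
  constructor
  · rintro ⟨hxy, hyx⟩
    exact ⟨fun h => hopen (.inr ⟨x, y, h, hxy⟩), fun h => hopen (.inr ⟨y, x, h, hyx⟩)⟩
  · rintro ⟨hxy, hyx⟩
    exact ((hsat.caseD x hx y hy).resolve_left hxy).resolve_left hyx

section Truth

variable {b : Branch} {W : Type} [PartialOrder W] {f : ℕ → W}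

theorem sepW_iff_sepIn (hsat : Saturated b) (hopen : OpenBranch b)
    (hle : ∀ x ∈ domB b, ∀ y ∈ domB b, (f x ≤ f y ↔ SEntry.Tle x y ∈ b)) {x y : ℕ}
    (hx : x ∈ domB b) (hy : y ∈ domB b) : SepW (f x) (f y) ↔ SepIn b x y := by
  rw [sepIn_iff hsat hopen hx hy, SepW, hle x hx y hy, hle y hy x hx]

theorem bifRel_iff_bifIn (hsat : Saturated b) (hopen : OpenBranch b)
    (hle : ∀ x ∈ domB b, ∀ y ∈ domB b, (f x ≤ f y ↔ SEntry.Tle x y ∈ b)) {x y z : ℕ}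
    (hx : x ∈ domB b) (hy : y ∈ domB b) (hz : z ∈ domB b) :
    BifRel (f x) (f y) (f z) ↔ BifIn b x y z := by
  rw [BifRel, BifIn, hle x hx y hy, hle x hx z hz, sepW_iff_sepIn hsat hopen hle hy hz]

theorem sepW_persist (hsat : Saturated b) (hopen : OpenBranch b)
    (hsurj : ∀ w : W, ∃ x ∈ domB b, f x = w)
    (hle : ∀ x ∈ domB b, ∀ y ∈ domB b, (f x ≤ f y ↔ SEntry.Tle x y ∈ b))
    (w₁ w₂ w₁' : W) (hsep : SepW w₁ w₂) (hw : w₁ ≤ w₁') : SepW w₁' w₂ := by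
  obtain ⟨x, hx, rfl⟩ := hsurj w₁
  obtain ⟨y, hy, rfl⟩ := hsurj w₂
  obtain ⟨z, hz, rfl⟩ := hsurj w₁'
  exact (sepW_iff_sepIn hsat hopen hle hz hy).2 (hsat.sepP x y z
    ((sepW_iff_sepIn hsat hopen hle hx hy).1 hsep) ((hle x hx z hz).1 hw))

theorem truth_lemma {V : W → ℕ → Prop} (hsat : Saturated b) (hopen : OpenBranch b)
    (hsurj : ∀ w : W, ∃ x ∈ domB b, f x = w)
    (hle : ∀ x ∈ domB b, ∀ y ∈ domB b, (f x ≤ f y ↔ SEntry.Tle x y ∈ b))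
    (hV : ∀ x ∈ domB b, ∀ p : ℕ, (V (f x) p ↔ SEntry.Tf (.atom p) x ∈ b)) (A : BLForm) :
    ∀ x ∈ domB b, (SEntry.Tf A x ∈ b → Sat V A (f x)) ∧
      (SEntry.Ff A x ∈ b → ¬ Sat V A (f x)) := by
  have hbif {x y z : ℕ} := @bifRel_iff_bifIn b W _ f hsat hopen hle x y z
  induction A with
  | atom p =>
    exact fun x hx => ⟨(hV x hx p).2, fun hF hT => hopen (.inl ⟨_, x, (hV x hx p).1 hT, hF⟩)⟩
  | neg A ih =>
    exact fun x hx => ⟨fun h => (ih x hx).2 (hsat.tneg A x h),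
      fun h hn => hn ((ih x hx).1 (hsat.fneg A x h))⟩
  | conj A B ihA ihB =>
    refine fun x hx => ⟨fun h => ?_, fun h hs => ?_⟩
    · obtain ⟨hA, hB⟩ := hsat.tconj A B x h
      exact ⟨(ihA x hx).1 hA, (ihB x hx).1 hB⟩
    · exact (hsat.fconj A B x h).elim (fun hA => (ihA x hx).2 hA hs.1)
        (fun hB => (ihB x hx).2 hB hs.2)
  | box A ih =>
    refine fun x hx => ⟨fun h w hw => ?_, fun h hs => ?_⟩
    · obtain ⟨y, hy, rfl⟩ := hsurj w
      exact (ih y hy).1 (hsat.tbox A x h y hy ((hle x hx y hy).1 hw))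
    · obtain ⟨y, hy, hxy, hA⟩ := hsat.fbox A x h
      exact (ih y hy).2 hA (hs (f y) ((hle x hx y hy).2 hxy))
  | star A B ihA ihB =>
    refine fun x hx => ⟨fun h => ?_, ?_⟩
    · obtain ⟨y, hy, z, hz, hxyz, hA, hB⟩ := hsat.tstar A B x h
      exact ⟨f y, f z, (hbif hx hy hz).2 hxyz, (ihA y hy).1 hA, (ihB z hz).1 hB⟩
    · rintro h ⟨w₁, w₂, hr, hA, hB⟩
      obtain ⟨y, hy, rfl⟩ := hsurj w₁
      obtain ⟨z, hz, rfl⟩ := hsurj w₂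
      exact (hsat.fstar A B x h y hy z hz ((hbif hx hy hz).1 hr)).elim
        (fun hF => (ihA y hy).2 hF hA) (fun hF => (ihB z hz).2 hF hB)
  | wand A B ihA ihB =>
    refine fun x hx => ⟨fun h w₁ w₂ hr hA => ?_, fun h hs => ?_⟩
    · obtain ⟨y, hy, rfl⟩ := hsurj w₁
      obtain ⟨z, hz, rfl⟩ := hsurj w₂
      exact (hsat.twand A B x h y hy z hz ((hbif hz hx hy).1 hr)).elim
        (fun hF => absurd hA ((ihA y hy).2 hF)) (ihB z hz).1
    · obtain ⟨y, hy, z, hz, hzxy, hA, hB⟩ := hsat.fwand A B x h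
      exact (ihB z hz).2 hB (hs (f y) (f z) ((hbif hz hx hy).2 hzxy) ((ihA y hy).1 hA))

end Truth

/-- The domain of a branch as a type, without the order inherited from `ℕ`. -/
structure DomType (b : Branch) : Type where
  val : ℕ
  mem : val ∈ domB b

/-- The preorder `x ⪯ y` on the domain of a saturated branch. -/
@[reducible] def Saturated.preorder {b : Branch} (hsat : Saturated b) : Preorder (DomType b) where
  le x y := preB b x.val y.val
  le_refl x := hsat.refl x.val x.mem
  le_trans x y z := hsat.trans x.val y.val z.val

/-- Model existence (truth lemma): a saturated open branch `b` whose induced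
quotient is rooted gives rise to a BL model `M` on the quotient
`dom(b)/∼` (presented by a surjection `f` from labels to worlds) such that
`T A:x ∈ b` implies `[x] ⊩ A` and `F A:x ∈ b` implies `[x] ⊮ A`. -/
theorem model_existence (b : Branch) (hsat : Saturated b) (hopen : OpenBranch b)
    (hroot : ∃ x0 ∈ domB b, ∀ x ∈ domB b, SEntry.Tle x0 x ∈ b) :
    ∃ (W : Type) (inst : PartialOrder W) (M : @BLModel W inst) (f : ℕ → W),
      @InducedModelOn W inst M f b ∧
      (∀ (A : BLForm), ∀ x ∈ domB b, SEntry.Tf A x ∈ b → @Sat W inst M.V A (f x)) ∧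
      (∀ (A : BLForm), ∀ x ∈ domB b, SEntry.Ff A x ∈ b → ¬ @Sat W inst M.V A (f x)) := by
  classical
  obtain ⟨x₀, hx₀, hmin⟩ := hroot
  let _ : Preorder (DomType b) := hsat.preorder
  let f : ℕ → Antisymmetrization (DomType b) (· ≤ ·) := fun n =>
    toAntisymmetrization (· ≤ ·) (if h : n ∈ domB b then ⟨n, h⟩ else ⟨x₀, hx₀⟩)
  have hf (x : ℕ) (hx : x ∈ domB b) : f x = toAntisymmetrization (· ≤ ·) ⟨x, hx⟩ := by
    simp only [f, dif_pos hx]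
  have hsurj : ∀ w, ∃ x ∈ domB b, f x = w := by
    intro w
    induction w using Antisymmetrization.ind with
    | _ x => exact ⟨x.val, x.mem, hf x.val x.mem⟩
  have hle : ∀ x ∈ domB b, ∀ y ∈ domB b, (f x ≤ f y ↔ SEntry.Tle x y ∈ b) := by
    intro x hx y hy
    rw [hf x hx, hf y hy, toAntisymmetrization_le_toAntisymmetrization_iff]
    rfl
  let M : BLModel (Antisymmetrization (DomType b) (· ≤ ·)) :=
    { rooted := ⟨f x₀, fun w => by
        obtain ⟨x, hx, rfl⟩ := hsurj w
        exact (hle x₀ hx₀ x hx).2 (hmin x hx)⟩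
      persist := sepW_persist hsat hopen hsurj hle
      V := fun w p => ∃ x ∈ domB b, f x = w ∧ SEntry.Tf (.atom p) x ∈ b }
  have hV : ∀ x ∈ domB b, ∀ p, (M.V (f x) p ↔ SEntry.Tf (.atom p) x ∈ b) := by
    refine fun x hx p => ⟨?_, fun h => ⟨x, hx, rfl, h⟩⟩
    rintro ⟨y, hy, hyx, h⟩
    exact hsat.equT _ y x ((hle y hy x hx).1 hyx.le) ((hle x hx y hy).1 hyx.ge) h
  have htruth := truth_lemma hsat hopen hsurj hle hV
  exact ⟨_, _, M, f, ⟨hsurj, hle, hV⟩, fun A x hx => (htruth A x hx).1,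
    fun A x hx => (htruth A x hx).2⟩
end

section
/- The finite model property fails for BL: if M is a BL model and w is a world of M with w ⊩ ◻(⊤ ∗ ⊤), then the set of worlds of M is infinite (since ◻(⊤ ∗ ⊤) forces every world above w to have two separated successors). -/
/-- The finite model property fails for BL: any world of a BL model satisfying
`◻(⊤ ∗ ⊤)` forces the set of worlds to be infinite. -/
theorem box_top_star_top_forces_infinite (W : Type) [PartialOrder W]
    (M : BLModel W) (w : W)
    (h : Sat M.V (BLForm.box (BLForm.star BLForm.top BLForm.top)) w) :
    Infinite W := by
  by_contra hfin
  rw [not_infinite_iff_finite] at hfin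
  obtain ⟨m, hwm, hm⟩ := Set.Finite.exists_le_maximal (Set.toFinite (Set.univ : Set W))
    (Set.mem_univ w)
  obtain ⟨w₁, w₂, ⟨h₁, h₂, hsep⟩, -⟩ := h m hwm
  exact hsep.1 ((hm.2 (Set.mem_univ w₁) h₁).trans h₂)
end

section
/- Decidability of the wand-free fragment of BL: the set of —∗-free BL formulas that are valid in BL is decidable, i.e., there is a computable function that, given a BL formula containing no occurrence of —∗, decides whether it is true at every world of every BL model. -/
/-- A formula containing no occurrence of `—∗`. -/
def WandFree : BLForm → Prop
  | .atom _ => True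
  | .neg A => WandFree A
  | .conj A B => WandFree A ∧ WandFree B
  | .box A => WandFree A
  | .star A B => WandFree A ∧ WandFree B
  | .wand _ _ => False

/-- An explicit effective numbering of BL formulas. -/
def encBL : BLForm → ℕ
  | .atom p => Nat.pair 0 p
  | .neg A => Nat.pair 1 (encBL A)
  | .conj A B => Nat.pair 2 (Nat.pair (encBL A) (encBL B))
  | .box A => Nat.pair 3 (encBL A)
  | .star A B => Nat.pair 4 (Nat.pair (encBL A) (encBL B))
  | .wand A B => Nat.pair 5 (Nat.pair (encBL A) (encBL B))

namespace BLDecide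

/-- The outermost connective of the formula coded by `i`, as a tag. -/
def tag (i : ℕ) : ℕ := i.unpair.1

/-- The code of the argument of a formula with a unary connective. -/
def arg (i : ℕ) : ℕ := i.unpair.2

/-- The code of the left argument of a formula with a binary connective. -/
def lft (i : ℕ) : ℕ := i.unpair.2.unpair.1

/-- The code of the right argument of a formula with a binary connective. -/
def rgt (i : ℕ) : ℕ := i.unpair.2.unpair.2

theorem arg_lt {i : ℕ} (h : 0 < tag i) : arg i < i := by
  have := (Nat.right_le_pair 0 _).trans_lt (Nat.pair_lt_pair_left (arg i) h)
  rwa [tag, arg, Nat.pair_unpair] at this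

theorem lft_lt {i : ℕ} (h : 0 < tag i) : lft i < i :=
  (Nat.unpair_left_le _).trans_lt (arg_lt h)

theorem rgt_lt {i : ℕ} (h : 0 < tag i) : rgt i < i :=
  (Nat.unpair_right_le _).trans_lt (arg_lt h)

theorem pair_one_arg_lt {i : ℕ} (h : tag i = 3) : Nat.pair 1 (arg i) < i := by
  have := Nat.pair_lt_pair_left (arg i) (show 1 < tag i by omega)
  rwa [tag, arg, Nat.pair_unpair] at this

theorem tag_pair (a b : ℕ) : tag (Nat.pair a b) = a := by simp [tag]

theorem arg_pair (a b : ℕ) : arg (Nat.pair a b) = b := by simp [arg]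

theorem lft_pair (a b c : ℕ) : lft (Nat.pair a (Nat.pair b c)) = b := by simp [lft]

theorem rgt_pair (a b c : ℕ) : rgt (Nat.pair a (Nat.pair b c)) = c := by simp [rgt]

/-- A pseudo-forest whose worlds are labelled by codes of formulas, the labels below `M`
obeying the satisfaction clauses of the connectives other than `—∗`. -/
structure Labelled (M : ℕ) {W : Type} [PartialOrder W] (L : W → ℕ → Prop) : Prop where
  forest : ∀ a b c : W, a ≤ c → b ≤ c → a ≤ b ∨ b ≤ a
  neg : ∀ w, ∀ i < M, tag i = 1 → (L w i ↔ ¬ L w (arg i))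
  conj : ∀ w, ∀ i < M, tag i = 2 → (L w i ↔ L w (lft i) ∧ L w (rgt i))
  box : ∀ w, ∀ i < M, tag i = 3 → (L w i ↔ ∀ v, w ≤ v → L v (arg i))
  star : ∀ w, ∀ i < M, tag i = 4 →
    (L w i ↔ ∃ v₁ v₂, BifRel w v₁ v₂ ∧ L v₁ (lft i) ∧ L v₂ (rgt i))

/-- The state of a set of worlds: the codes satisfied somewhere in it, and the codes of separating
conjunctions whose arguments are satisfied at separated worlds of it. -/
abbrev State := List ℕ × List ℕ

/-- `s` is, on the codes below `M`, the state of the set of worlds `U`. -/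
def IsState (M : ℕ) {W : Type} [PartialOrder W] (L : W → ℕ → Prop) (U : Set W)
    (s : State) : Prop :=
  ∀ i < M, (i ∈ s.1 ↔ ∃ w ∈ U, L w i) ∧
    (i ∈ s.2 ↔ tag i = 4 ∧ ∃ w₁ ∈ U, ∃ w₂ ∈ U, SepW w₁ w₂ ∧ L w₁ (lft i) ∧ L w₂ (rgt i))

/-- All lists of codes below `M`. -/
def codeLists (M : ℕ) : List (List ℕ) := (List.range M).sublists'

/-- All states on codes below `M`. -/
def states (M : ℕ) : List State := codeLists M ×ˢ codeLists M

/-- The local condition at the code `i` for `t` to be the set of codes satisfied at a world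
whose upper set has state `s`. -/
def CoherentAt (i : ℕ) (t : List ℕ) (s : State) : Prop :=
  (i ∈ t → i ∈ s.1) ∧ (tag i = 1 → (i ∈ t ↔ arg i ∉ t)) ∧
    (tag i = 2 → (i ∈ t ↔ lft i ∈ t ∧ rgt i ∈ t)) ∧
    (tag i = 3 → (i ∈ t ↔ Nat.pair 1 (arg i) ∉ s.1)) ∧ (tag i = 4 → (i ∈ t ↔ i ∈ s.2))

/-- `t` may be the set of codes satisfied at a world whose upper set has state `s`. -/
def Coherent (M : ℕ) (t : List ℕ) (s : State) : Prop := ∀ i < M, CoherentAt i t s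

/-- `s` is obtained from `s₁` and `s₂` by adding worlds labelled coherently with `s`. -/
def Covers (M : ℕ) (s₁ s₂ s : State) : Prop :=
  (∃ t ∈ codeLists M, Coherent M t s) ∧
    ∀ i < M, (i ∈ s₁.1 ∨ i ∈ s₂.1 → i ∈ s.1) ∧
      (i ∈ s.1 → i ∈ s₁.1 ∨ i ∈ s₂.1 ∨ ∃ t ∈ codeLists M, Coherent M t s ∧ i ∈ t)

/-- `s` is the state of the disjoint union of sets of states `s₁` and `s₂`. -/
def UnionStep (M : ℕ) (s₁ s₂ s : State) : Prop :=
  ∀ i < M, (i ∈ s.1 ↔ i ∈ s₁.1 ∨ i ∈ s₂.1) ∧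
    (i ∈ s.2 ↔ i ∈ s₁.2 ∨ i ∈ s₂.2 ∨
      tag i = 4 ∧ (lft i ∈ s₁.1 ∧ rgt i ∈ s₂.1 ∨ lft i ∈ s₂.1 ∧ rgt i ∈ s₁.1))

/-- `s` is the state of a chain with side branches of state `s₁`, below a set of state `s₂`. -/
def ChainStep (M : ℕ) (s₁ s₂ s : State) : Prop :=
  Covers M s₁ s₂ s ∧ ∀ i < M, (i ∈ s.2 ↔ i ∈ s₂.2 ∨
    tag i = 4 ∧ (lft i ∈ s₁.1 ∧ rgt i ∈ s.1 ∨ lft i ∈ s.1 ∧ rgt i ∈ s₁.1))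

/-- `s` is the state of a fully branching tree with side branches of state `s₁`. -/
def BranchStep (M : ℕ) (s₁ s : State) : Prop :=
  Covers M s₁ s₁ s ∧ ∀ i < M, (i ∈ s.2 ↔ tag i = 4 ∧ lft i ∈ s.1 ∧ rgt i ∈ s.1)

/-- `s` is obtained from `s₁` and `s₂` by one of the three constructions. -/
def Step (M : ℕ) (s₁ s₂ s : State) : Prop :=
  UnionStep M s₁ s₂ s ∨ ChainStep M s₁ s₂ s ∨ BranchStep M s₁ s

/-- `R` contains the empty state and all states below `M` obtained by steps from its members. -/
def Closed (M : ℕ) (R : List State) : Prop :=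
  ([], []) ∈ R ∧ ∀ s₁ ∈ R, ∀ s₂ ∈ R, ∀ s ∈ states M, Step M s₁ s₂ s → s ∈ R

section Soundness

open Classical in
/-- The list of codes below `M` satisfying `P`. -/
noncomputable def codesOf (M : ℕ) (P : ℕ → Prop) : List ℕ := (List.range M).filter (fun i => P i)

theorem mem_codesOf {M i : ℕ} {P : ℕ → Prop} : i ∈ codesOf M P ↔ i < M ∧ P i := by
  simp [codesOf]

theorem codesOf_mem_codeLists (M : ℕ) (P : ℕ → Prop) : codesOf M P ∈ codeLists M := by
  simp [codesOf, codeLists]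

variable {M : ℕ} {W : Type} [PartialOrder W] {L : W → ℕ → Prop}

/-- The canonical state of a set of worlds. -/
noncomputable def stateOf (M : ℕ) (L : W → ℕ → Prop) (U : Set W) : State :=
  (codesOf M fun i => ∃ w ∈ U, L w i,
    codesOf M fun i => tag i = 4 ∧
      ∃ w₁ ∈ U, ∃ w₂ ∈ U, SepW w₁ w₂ ∧ L w₁ (lft i) ∧ L w₂ (rgt i))

theorem stateOf_mem_states (U : Set W) : stateOf M L U ∈ states M := by
  simp [states, stateOf, codesOf_mem_codeLists]

theorem mem_stateOf_fst {U : Set W} {i : ℕ} :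
    i ∈ (stateOf M L U).1 ↔ i < M ∧ ∃ w ∈ U, L w i := mem_codesOf

theorem mem_stateOf_snd {U : Set W} {i : ℕ} :
    i ∈ (stateOf M L U).2 ↔ i < M ∧ tag i = 4 ∧
      ∃ w₁ ∈ U, ∃ w₂ ∈ U, SepW w₁ w₂ ∧ L w₁ (lft i) ∧ L w₂ (rgt i) := mem_codesOf

theorem stateOf_sublist {U U' : Set W} (h : U ⊆ U') :
    (stateOf M L U).1.Sublist (stateOf M L U').1 ∧
      (stateOf M L U).2.Sublist (stateOf M L U').2 := by
  constructor <;> refine List.monotone_filter_right _ fun i => ?_ <;>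
    simp only [decide_eq_true_eq]
  · rintro ⟨w, hw, hl⟩
    exact ⟨w, h hw, hl⟩
  · rintro ⟨ht, w₁, h₁, w₂, h₂, hl⟩
    exact ⟨ht, w₁, h h₁, w₂, h h₂, hl⟩

theorem SepW.mono (hW : ∀ a b c : W, a ≤ c → b ≤ c → a ≤ b ∨ b ≤ a) {a b a' b' : W}
    (h : SepW a b) (ha : a ≤ a') (hb : b ≤ b') : SepW a' b' := by
  constructor <;> intro hle
  · rcases hW a b b' (ha.trans hle) hb with h' | h'
    exacts [h.1 h', h.2 h']
  · rcases hW a b a' ha (hb.trans hle) with h' | h'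
    exacts [h.1 h', h.2 h']

theorem Labelled.sep_mono (hL : Labelled M L) {a b a' b' : W} (h : SepW a b) (ha : a ≤ a')
    (hb : b ≤ b') : SepW a' b' := SepW.mono hL.forest h ha hb

/-- The labels below `M` of a world are coherent with the state of its upper set. -/
theorem Labelled.coherent (hL : Labelled M L) (v : W) :
    Coherent M (codesOf M (L v)) (stateOf M L (Set.Ici v)) := by
  intro i hi
  refine ⟨?_, fun h => ?_, fun h => ?_, fun h => ?_, fun h => ?_⟩
  · rw [mem_codesOf, mem_stateOf_fst]
    exact fun h => ⟨hi, v, le_rfl, h.2⟩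
  · have := arg_lt (i := i) (by omega)
    simp only [mem_codesOf, hi, this.trans hi, true_and, hL.neg v i hi h]
  · have h₁ := lft_lt (i := i) (by omega)
    have h₂ := rgt_lt (i := i) (by omega)
    simp only [mem_codesOf, hi, h₁.trans hi, h₂.trans hi, true_and, hL.conj v i hi h]
  · have h₁ := (pair_one_arg_lt h).trans hi
    simp only [mem_codesOf, mem_stateOf_fst, hi, h₁, true_and, hL.box v i hi h,
      hL.neg _ _ h₁ (tag_pair _ _), arg_pair]
    simp
  · simp only [mem_codesOf, mem_stateOf_snd, hi, true_and, hL.star v i hi h, h]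
    constructor
    · rintro ⟨v₁, v₂, ⟨h₁, h₂, hs⟩, hl⟩
      exact ⟨v₁, h₁, v₂, h₂, hs, hl⟩
    · rintro ⟨v₁, h₁, v₂, h₂, hs, hl⟩
      exact ⟨v₁, v₂, ⟨h₁, h₂, hs⟩, hl⟩

/-- The upper set of a finite set of worlds has its state in `R` as soon as the principal upper
sets of its members do. -/
theorem Labelled.stateOf_finset_mem (hL : Labelled M L) {R : List State} (hR : Closed M R)
    (n : ℕ) : ∀ X : Finset W, X.card = n → (∀ x ∈ X, stateOf M L (Set.Ici x) ∈ R) →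
      stateOf M L {v | ∃ x ∈ X, x ≤ v} ∈ R := by
  classical
  induction n using Nat.strong_induction_on with
  | _ n ih =>
  intro X hn hX
  rcases X.eq_empty_or_nonempty with rfl | hne
  · have : stateOf M L {v | ∃ x ∈ (∅ : Finset W), x ≤ v} = ([], []) := by
      refine Prod.ext (List.eq_nil_iff_forall_not_mem.2 fun i => ?_)
        (List.eq_nil_iff_forall_not_mem.2 fun i => ?_)
      · simp [mem_stateOf_fst]
      · simp [mem_stateOf_snd]
    rw [this]
    exact hR.1
  · obtain ⟨m, hm⟩ := X.exists_minimal hne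
    have hmX : m ∈ X := hm.1
    set Y := X.filter fun y => ¬ m ≤ y with hY
    have hlt : Y.card < n := by
      rw [← hn]
      exact Finset.card_lt_card (Finset.filter_ssubset.2 ⟨m, hmX, by simp⟩)
    have hYR := ih _ hlt Y rfl fun x hx => hX x (Finset.mem_filter.1 hx).1
    have hsep : ∀ a, m ≤ a → ∀ b, (∃ x ∈ Y, x ≤ b) → SepW a b := by
      rintro a ha b ⟨x, hx, hxb⟩
      obtain ⟨hxX, hmx⟩ := Finset.mem_filter.1 hx
      exact hL.sep_mono ⟨hmx, fun h => hmx (hm.2 hxX h)⟩ ha hxb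
    have hsplit : ∀ v, (∃ x ∈ X, x ≤ v) ↔ m ≤ v ∨ ∃ x ∈ Y, x ≤ v := by
      intro v
      constructor
      · rintro ⟨x, hx, hxv⟩
        by_cases h : m ≤ x
        · exact .inl (h.trans hxv)
        · exact .inr ⟨x, Finset.mem_filter.2 ⟨hx, h⟩, hxv⟩
      · rintro (h | ⟨x, hx, hxv⟩)
        · exact ⟨m, hmX, h⟩
        · exact ⟨x, (Finset.mem_filter.1 hx).1, hxv⟩
    refine hR.2 _ (hX m hmX) _ hYR _ (stateOf_mem_states _) (.inl fun i hi => ⟨?_, ?_⟩)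
    · simp only [mem_stateOf_fst, hi, true_and, Set.mem_ofPred_eq, Set.mem_Ici, hsplit]
      grind
    · by_cases ht : tag i = 4
      · have h₁ := (lft_lt (i := i) (by omega)).trans hi
        have h₂ := (rgt_lt (i := i) (by omega)).trans hi
        simp only [mem_stateOf_fst, mem_stateOf_snd, hi, h₁, h₂, ht, true_and, Set.mem_ofPred_eq,
          Set.mem_Ici, hsplit]
        constructor
        · rintro ⟨a, ha | ha, b, hb | hb, hs, hla, hlb⟩
          · exact .inl ⟨a, ha, b, hb, hs, hla, hlb⟩
          · exact .inr (.inr (.inl ⟨⟨a, ha, hla⟩, ⟨b, hb, hlb⟩⟩))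
          · exact .inr (.inr (.inr ⟨⟨a, ha, hla⟩, ⟨b, hb, hlb⟩⟩))
          · exact .inr (.inl ⟨a, ha, b, hb, hs, hla, hlb⟩)
        · rintro (⟨a, ha, b, hb, h⟩ | ⟨a, ha, b, hb, h⟩ | ⟨⟨a, ha, hla⟩, ⟨b, hb, hlb⟩⟩ |
            ⟨⟨a, ha, hla⟩, ⟨b, hb, hlb⟩⟩)
          · exact ⟨a, .inl ha, b, .inl hb, h⟩
          · exact ⟨a, .inr ha, b, .inr hb, h⟩
          · exact ⟨a, .inl ha, b, .inr hb, hsep a ha b hb, hla, hlb⟩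
          · exact ⟨a, .inr ha, b, .inl hb, (hsep b hb a ha).symm, hla, hlb⟩
      · simp [mem_stateOf_snd, ht]

/-- An upper set has its state in `R` as soon as the principal upper sets of its members do. -/
theorem Labelled.stateOf_upper_mem (hL : Labelled M L) {R : List State} (hR : Closed M R)
    {U : Set W} (hU : ∀ x ∈ U, ∀ y, x ≤ y → y ∈ U)
    (hUR : ∀ x ∈ U, stateOf M L (Set.Ici x) ∈ R) : stateOf M L U ∈ R := by
  classical
  by_cases hne : U.Nonempty
  swap
  · rw [Set.not_nonempty_iff_eq_empty.1 hne]
    simpa using hL.stateOf_finset_mem hR _ ∅ rfl (by simp)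
  obtain ⟨u, hu⟩ := hne
  have h₁ : ∀ i, ∃ w ∈ U, i ∈ (stateOf M L U).1 → L w i := by
    intro i
    by_cases h : i ∈ (stateOf M L U).1
    · obtain ⟨-, w, hw, hl⟩ := mem_stateOf_fst.1 h
      exact ⟨w, hw, fun _ => hl⟩
    · exact ⟨u, hu, fun h' => absurd h' h⟩
  have h₂ : ∀ i, ∃ a ∈ U, ∃ b ∈ U, i ∈ (stateOf M L U).2 →
      SepW a b ∧ L a (lft i) ∧ L b (rgt i) := by
    intro i
    by_cases h : i ∈ (stateOf M L U).2
    · obtain ⟨-, -, a, ha, b, hb, hl⟩ := mem_stateOf_snd.1 h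
      exact ⟨a, ha, b, hb, fun _ => hl⟩
    · exact ⟨u, hu, u, hu, fun h' => absurd h' h⟩
  choose f hfU hf using h₁
  choose g hgU g' hgU' hg using h₂
  let X : Finset W := (Finset.range M).image f ∪ ((Finset.range M).image g ∪
    (Finset.range M).image g')
  have hXf : ∀ i < M, f i ∈ X := fun i hi => by
    simp only [X, Finset.mem_union, Finset.mem_image, Finset.mem_range]
    grind
  have hXg : ∀ i < M, g i ∈ X := fun i hi => by
    simp only [X, Finset.mem_union, Finset.mem_image, Finset.mem_range]
    grind
  have hXg' : ∀ i < M, g' i ∈ X := fun i hi => by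
    simp only [X, Finset.mem_union, Finset.mem_image, Finset.mem_range]
    grind
  have hXU : ∀ x ∈ X, x ∈ U := by
    intro x hx
    simp only [X, Finset.mem_union, Finset.mem_image, Finset.mem_range] at hx
    grind
  have key := hL.stateOf_finset_mem hR _ X rfl fun x hx => hUR x (hXU x hx)
  have hsub : {v | ∃ x ∈ X, x ≤ v} ⊆ U := by
    rintro v ⟨x, hx, hxv⟩
    exact hU x (hXU x hx) v hxv
  convert key using 1
  refine Prod.ext (List.filter_congr fun i hi => ?_) (List.filter_congr fun i hi => ?_)
  · have hi' := List.mem_range.1 hi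
    refine decide_eq_decide.2 ⟨fun h => ?_, fun ⟨w, hw, hl⟩ => ⟨w, hsub hw, hl⟩⟩
    exact ⟨f i, ⟨_, hXf i hi', le_rfl⟩, hf i (mem_stateOf_fst.2 ⟨hi', h⟩)⟩
  · have hi' := List.mem_range.1 hi
    refine decide_eq_decide.2 ⟨fun h => ⟨h.1, ?_⟩,
      fun ⟨h, a, ha, b, hb, hl⟩ => ⟨h, a, hsub ha, b, hsub hb, hl⟩⟩
    exact ⟨g i, ⟨_, hXg i hi', le_rfl⟩, g' i, ⟨_, hXg' i hi', le_rfl⟩,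
      hg i (mem_stateOf_snd.2 ⟨hi', h⟩)⟩

/-- A closed set of states contains the states of all principal upper sets, by induction on the
size of the state. -/
theorem Labelled.stateOf_Ici_mem (hL : Labelled M L) {R : List State} (hR : Closed M R) (n : ℕ) :
    ∀ w : W, (stateOf M L (Set.Ici w)).1.length + (stateOf M L (Set.Ici w)).2.length = n →
      stateOf M L (Set.Ici w) ∈ R := by
  induction n using Nat.strong_induction_on with
  | _ n ih =>
  intro w hn
  set s := stateOf M L (Set.Ici w) with hs
  have hsublist : ∀ v, w ≤ v → (stateOf M L (Set.Ici v)).1.Sublist s.1 ∧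
      (stateOf M L (Set.Ici v)).2.Sublist s.2 :=
    fun v hv => stateOf_sublist (Set.Ici_subset_Ici.2 hv)
  have hsmall : ∀ v, w ≤ v → stateOf M L (Set.Ici v) ≠ s → stateOf M L (Set.Ici v) ∈ R := by
    intro v hv hne
    obtain ⟨h₁, h₂⟩ := hsublist v hv
    refine ih _ ?_ v rfl
    rw [← hn]
    by_contra hlt
    have l₁ := h₁.length_le
    have l₂ := h₂.length_le
    exact hne (Prod.ext (h₁.eq_of_length (by omega)) (h₂.eq_of_length (by omega)))
  have hconv : ∀ c v, w ≤ v → v ≤ c → stateOf M L (Set.Ici c) = s →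
      stateOf M L (Set.Ici v) = s := by
    intro c v hv hvc hc
    obtain ⟨h₁, h₂⟩ := hsublist v hv
    have h := stateOf_sublist (M := M) (L := L) (Set.Ici_subset_Ici.2 hvc)
    rw [hc] at h
    exact Prod.ext (h₁.antisymm h.1) (h₂.antisymm h.2)
  have hcoh : ∀ v, stateOf M L (Set.Ici v) = s → Coherent M (codesOf M (L v)) s :=
    fun v hv => hv ▸ hL.coherent v
  have hU : ∀ x, w ≤ x → stateOf M L (Set.Ici x) ≠ s → ∀ y, x ≤ y →
      w ≤ y ∧ stateOf M L (Set.Ici y) ≠ s :=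
    fun x hx hne y hxy => ⟨hx.trans hxy, fun h => hne (hconv y x hx hxy h)⟩
  have hcover : ∀ U₁ U₂ : Set W, U₁ ⊆ Set.Ici w → U₂ ⊆ Set.Ici w →
      (∀ v, w ≤ v → stateOf M L (Set.Ici v) ≠ s → v ∈ U₁ ∨ v ∈ U₂) →
      Covers M (stateOf M L U₁) (stateOf M L U₂) s := by
    intro U₁ U₂ hU₁ hU₂ h
    refine ⟨⟨_, codesOf_mem_codeLists _ _, hcoh w rfl⟩, fun i hi => ⟨?_, fun his => ?_⟩⟩
    · rintro (h' | h')
      · exact (stateOf_sublist hU₁).1.subset h'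
      · exact (stateOf_sublist hU₂).1.subset h'
    · obtain ⟨-, v, hv, hl⟩ := mem_stateOf_fst.1 his
      by_cases hvs : stateOf M L (Set.Ici v) = s
      · exact .inr (.inr ⟨_, codesOf_mem_codeLists _ _, hcoh v hvs, mem_codesOf.2 ⟨hi, hl⟩⟩)
      · rcases h v hv hvs with h' | h'
        · exact .inl (mem_stateOf_fst.2 ⟨hi, v, h', hl⟩)
        · exact .inr (.inl (mem_stateOf_fst.2 ⟨hi, v, h', hl⟩))
  by_cases hbr : ∃ a b, w ≤ a ∧ w ≤ b ∧ SepW a b ∧ stateOf M L (Set.Ici a) = s ∧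
      stateOf M L (Set.Ici b) = s
  · obtain ⟨a, b, ha, hb, hab, has, hbs⟩ := hbr
    let U : Set W := {v | w ≤ v ∧ stateOf M L (Set.Ici v) ≠ s}
    have hUR : stateOf M L U ∈ R := hL.stateOf_upper_mem hR
      (fun x hx y hxy => hU x hx.1 hx.2 y hxy) fun x hx => hsmall x hx.1 hx.2
    refine hR.2 _ hUR _ hUR _ (stateOf_mem_states _) (.inr (.inr ⟨?_, fun i hi => ?_⟩))
    · exact hcover U U (fun v hv => hv.1) (fun v hv => hv.1) fun v hv hne => .inl ⟨hv, hne⟩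
    · constructor
      · intro h
        obtain ⟨-, ht, v₁, h₁, v₂, h₂, -, hl₁, hl₂⟩ := mem_stateOf_snd.1 h
        exact ⟨ht, mem_stateOf_fst.2 ⟨(lft_lt (by omega)).trans hi, v₁, h₁, hl₁⟩,
          mem_stateOf_fst.2 ⟨(rgt_lt (by omega)).trans hi, v₂, h₂, hl₂⟩⟩
      · rintro ⟨ht, hl, hr⟩
        rw [← has] at hl
        rw [← hbs] at hr
        obtain ⟨-, v₁, h₁, hl₁⟩ := mem_stateOf_fst.1 hl
        obtain ⟨-, v₂, h₂, hl₂⟩ := mem_stateOf_fst.1 hr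
        exact mem_stateOf_snd.2 ⟨hi, ht, v₁, ha.trans h₁, v₂, hb.trans h₂,
          hL.sep_mono hab h₁ h₂, hl₁, hl₂⟩
  · have hchain : ∀ a b, w ≤ a → w ≤ b → stateOf M L (Set.Ici a) = s →
        stateOf M L (Set.Ici b) = s → a ≤ b ∨ b ≤ a := by
      intro a b ha hb has hbs
      by_contra h
      rw [not_or] at h
      exact hbr ⟨a, b, ha, hb, h, has, hbs⟩
    let U₂ : Set W := {v | (w ≤ v ∧ stateOf M L (Set.Ici v) ≠ s) ∧
      ∀ c, w ≤ c → stateOf M L (Set.Ici c) = s → c ≤ v}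
    let U₁ : Set W := {v | (w ≤ v ∧ stateOf M L (Set.Ici v) ≠ s) ∧
      ∃ c, w ≤ c ∧ stateOf M L (Set.Ici c) = s ∧ SepW c v}
    have hU₁₂ : ∀ v, w ≤ v → stateOf M L (Set.Ici v) ≠ s → v ∈ U₁ ∨ v ∈ U₂ := by
      intro v hv hne
      by_cases h : ∃ c, w ≤ c ∧ stateOf M L (Set.Ici c) = s ∧ ¬ c ≤ v
      · obtain ⟨c, hc, hcs, hcv⟩ := h
        exact .inl ⟨⟨hv, hne⟩, c, hc, hcs, hcv, fun h => hne (hconv c v hv h hcs)⟩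
      · push Not at h
        exact .inr ⟨⟨hv, hne⟩, h⟩
    have hR₁ : stateOf M L U₁ ∈ R := by
      refine hL.stateOf_upper_mem hR ?_ fun x hx => hsmall x hx.1.1 hx.1.2
      rintro x ⟨hx, c, hc, hcs, hcx⟩ y hxy
      exact ⟨hU x hx.1 hx.2 y hxy, c, hc, hcs, hL.sep_mono hcx le_rfl hxy⟩
    have hR₂ : stateOf M L U₂ ∈ R := by
      refine hL.stateOf_upper_mem hR ?_ fun x hx => hsmall x hx.1.1 hx.1.2
      rintro x ⟨hx, hc⟩ y hxy
      exact ⟨hU x hx.1 hx.2 y hxy, fun c h h' => (hc c h h').trans hxy⟩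
    refine hR.2 _ hR₁ _ hR₂ _ (stateOf_mem_states _) (.inr (.inl ⟨?_, fun i hi => ?_⟩))
    · exact hcover U₁ U₂ (fun v hv => hv.1.1) (fun v hv => hv.1.1) hU₁₂
    · have hside : ∀ v₁ v₂, w ≤ v₁ → w ≤ v₂ → SepW v₁ v₂ → v₁ ∈ U₁ ∨ v₂ ∈ U₁ ∨
          (v₁ ∈ U₂ ∧ v₂ ∈ U₂) := by
        intro v₁ v₂ h₁ h₂ hsep
        by_cases e₁ : stateOf M L (Set.Ici v₁) = s
        · by_cases e₂ : stateOf M L (Set.Ici v₂) = s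
          · rcases hchain _ _ h₁ h₂ e₁ e₂ with h | h
            exacts [absurd h hsep.1, absurd h hsep.2]
          · rcases hU₁₂ _ h₂ e₂ with h | h
            · exact .inr (.inl h)
            · exact absurd (h.2 _ h₁ e₁) hsep.1
        · rcases hU₁₂ _ h₁ e₁ with h | h
          · exact .inl h
          · by_cases e₂ : stateOf M L (Set.Ici v₂) = s
            · exact absurd (h.2 _ h₂ e₂) hsep.2
            · rcases hU₁₂ _ h₂ e₂ with h' | h'
              · exact .inr (.inl h')
              · exact .inr (.inr ⟨h, h'⟩)
      constructor
      · intro h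
        obtain ⟨-, ht, v₁, h₁, v₂, h₂, hsep, hl₁, hl₂⟩ := mem_stateOf_snd.1 h
        have b₁ := (lft_lt (i := i) (by omega)).trans hi
        have b₂ := (rgt_lt (i := i) (by omega)).trans hi
        rcases hside v₁ v₂ h₁ h₂ hsep with h | h | ⟨h, h'⟩
        · exact .inr ⟨ht, .inl ⟨mem_stateOf_fst.2 ⟨b₁, v₁, h, hl₁⟩,
            mem_stateOf_fst.2 ⟨b₂, v₂, h₂, hl₂⟩⟩⟩
        · exact .inr ⟨ht, .inr ⟨mem_stateOf_fst.2 ⟨b₁, v₁, h₁, hl₁⟩,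
            mem_stateOf_fst.2 ⟨b₂, v₂, h, hl₂⟩⟩⟩
        · exact .inl (mem_stateOf_snd.2 ⟨hi, ht, v₁, h, v₂, h', hsep, hl₁, hl₂⟩)
      · rintro (h | ⟨ht, ⟨hl, hr⟩ | ⟨hl, hr⟩⟩)
        · exact (stateOf_sublist fun v hv => hv.1.1).2.subset h
        · obtain ⟨-, v, ⟨⟨hv, -⟩, c, hc, hcs, hsep⟩, hl⟩ := mem_stateOf_fst.1 hl
          rw [← hcs] at hr
          obtain ⟨-, u, hu, hr⟩ := mem_stateOf_fst.1 hr
          exact mem_stateOf_snd.2 ⟨hi, ht, v, hv, u, hc.trans hu,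
            (hL.sep_mono hsep hu le_rfl).symm, hl, hr⟩
        · obtain ⟨-, v, ⟨⟨hv, -⟩, c, hc, hcs, hsep⟩, hr⟩ := mem_stateOf_fst.1 hr
          rw [← hcs] at hl
          obtain ⟨-, u, hu, hl⟩ := mem_stateOf_fst.1 hl
          exact mem_stateOf_snd.2 ⟨hi, ht, u, hc.trans hu, v, hv,
            hL.sep_mono hsep hu le_rfl, hl, hr⟩

end Soundness

section Completeness

/-- A state is realized if it is the state of some labelled pseudo-forest. -/
def Realized (M : ℕ) (s : State) : Prop :=
  ∃ (W : Type) (_ : PartialOrder W) (L : W → ℕ → Prop), Labelled M L ∧ IsState M L Set.univ s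

theorem IsState.mem_fst {M : ℕ} {W : Type} [PartialOrder W] {L : W → ℕ → Prop} {s : State}
    (h : IsState M L Set.univ s) {i : ℕ} (hi : i < M) : i ∈ s.1 ↔ ∃ w, L w i := by
  simpa using (h i hi).1

theorem IsState.mem_snd {M : ℕ} {W : Type} [PartialOrder W] {L : W → ℕ → Prop} {s : State}
    (h : IsState M L Set.univ s) {i : ℕ} (hi : i < M) :
    i ∈ s.2 ↔ tag i = 4 ∧ ∃ w₁ w₂, SepW w₁ w₂ ∧ L w₁ (lft i) ∧ L w₂ (rgt i) := by
  simpa using (h i hi).2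

theorem labelled_of_isEmpty {M : ℕ} {W : Type} [PartialOrder W] [IsEmpty W]
    (L : W → ℕ → Prop) : Labelled M L := by
  constructor <;> exact fun a => isEmptyElim a

theorem realized_empty (M : ℕ) : Realized M ([], []) :=
  ⟨PEmpty, inferInstance, fun _ _ => False, labelled_of_isEmpty _, fun i _ => by simp⟩

theorem sepW_inl {α β : Type} [PartialOrder α] [PartialOrder β] {a b : α} :
    SepW (Sum.inl a : α ⊕ β) (Sum.inl b) ↔ SepW a b := by simp [SepW]

theorem sepW_inr {α β : Type} [PartialOrder α] [PartialOrder β] {a b : β} :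
    SepW (Sum.inr a : α ⊕ β) (Sum.inr b) ↔ SepW a b := by simp [SepW]

theorem sepW_inl_inr {α β : Type} [PartialOrder α] [PartialOrder β] (a : α) (b : β) :
    SepW (Sum.inl a : α ⊕ β) (Sum.inr b) := by simp [SepW]

theorem sepW_inr_inl {α β : Type} [PartialOrder α] [PartialOrder β] (a : α) (b : β) :
    SepW (Sum.inr b : α ⊕ β) (Sum.inl a) := by simp [SepW]

theorem Realized.union {M : ℕ} {s₁ s₂ s : State} (h₁ : Realized M s₁) (h₂ : Realized M s₂)
    (h : UnionStep M s₁ s₂ s) : Realized M s := by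
  obtain ⟨W₁, _, L₁, hL₁, hs₁⟩ := h₁
  obtain ⟨W₂, _, L₂, hL₂, hs₂⟩ := h₂
  refine ⟨W₁ ⊕ W₂, inferInstance, Sum.elim L₁ L₂, ⟨?_, ?_, ?_, ?_, ?_⟩, fun i hi => ?_⟩
  · rintro (a | a) (b | b) (c | c) <;> simp
    exacts [hL₁.forest a b c, hL₂.forest a b c]
  · rintro (w | w) i hi ht
    exacts [hL₁.neg w i hi ht, hL₂.neg w i hi ht]
  · rintro (w | w) i hi ht
    exacts [hL₁.conj w i hi ht, hL₂.conj w i hi ht]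
  · rintro (w | w) i hi ht
    · simpa using hL₁.box w i hi ht
    · simpa using hL₂.box w i hi ht
  · rintro (w | w) i hi ht
    · simpa [BifRel, sepW_inl] using hL₁.star w i hi ht
    · simpa [BifRel, sepW_inr] using hL₂.star w i hi ht
  · rw [(h i hi).1, (h i hi).2, hs₁.mem_fst hi, hs₂.mem_fst hi, hs₁.mem_snd hi, hs₂.mem_snd hi]
    refine ⟨by simp, ?_⟩
    by_cases ht : tag i = 4
    · have b₁ := (lft_lt (i := i) (by omega)).trans hi
      have b₂ := (rgt_lt (i := i) (by omega)).trans hi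
      rw [hs₁.mem_fst b₁, hs₂.mem_fst b₁, hs₁.mem_fst b₂, hs₂.mem_fst b₂]
      simp [ht, sepW_inl, sepW_inr, sepW_inl_inr, sepW_inr_inl]
      grind
    · simp [ht]

/-- A pseudo-forest `P` with a copy of `W₁` attached above each of its points, and a copy of `W₂`
above all of `P`. -/
inductive Glue (P W₁ W₂ : Type) : Type
  | base : P → Glue P W₁ W₂
  | side : P → W₁ → Glue P W₁ W₂
  | top : W₂ → Glue P W₁ W₂

namespace Glue

variable {P W₁ W₂ : Type} [PartialOrder P] [PartialOrder W₁] [PartialOrder W₂]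

/-- The order on `Glue P W₁ W₂`. -/
def le : Glue P W₁ W₂ → Glue P W₁ W₂ → Prop
  | base p, base q => p ≤ q
  | base p, side q _ => p ≤ q
  | base _, top _ => True
  | side p x, side q y => p = q ∧ x ≤ y
  | top x, top y => x ≤ y
  | _, _ => False

instance : PartialOrder (Glue P W₁ W₂) where
  le := le
  le_refl a := by cases a <;> simp [le]
  le_trans a b c := by
    cases a <;> cases b <;> cases c <;> simp only [le] <;> grind
  le_antisymm a b := by
    cases a <;> cases b <;> simp only [le] <;> grind

variable {p q : P} {x y : W₁} {z u : W₂}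

@[simp] theorem base_le_base : (base p : Glue P W₁ W₂) ≤ base q ↔ p ≤ q := Iff.rfl
@[simp] theorem base_le_side : (base p : Glue P W₁ W₂) ≤ side q x ↔ p ≤ q := Iff.rfl
@[simp] theorem base_le_top : (base p : Glue P W₁ W₂) ≤ top z ↔ True := Iff.rfl
@[simp] theorem side_le_base : (side q x : Glue P W₁ W₂) ≤ base p ↔ False := Iff.rfl
@[simp] theorem side_le_side : (side p x : Glue P W₁ W₂) ≤ side q y ↔ p = q ∧ x ≤ y := Iff.rfl
@[simp] theorem side_le_top : (side p x : Glue P W₁ W₂) ≤ top z ↔ False := Iff.rfl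
@[simp] theorem top_le_base : (top z : Glue P W₁ W₂) ≤ base p ↔ False := Iff.rfl
@[simp] theorem top_le_side : (top z : Glue P W₁ W₂) ≤ side p x ↔ False := Iff.rfl
@[simp] theorem top_le_top : (top z : Glue P W₁ W₂) ≤ top u ↔ z ≤ u := Iff.rfl

/-- The labelling of `Glue P W₁ W₂` induced by labellings of its parts. -/
def label (τ : P → List ℕ) (L₁ : W₁ → ℕ → Prop) (L₂ : W₂ → ℕ → Prop) : Glue P W₁ W₂ → ℕ → Prop
  | base p, i => i ∈ τ p
  | side _ x, i => L₁ x i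
  | top z, i => L₂ z i

theorem forest (hP : ∀ a b c : P, a ≤ c → b ≤ c → a ≤ b ∨ b ≤ a)
    (hPW : IsEmpty W₂ ∨ ∀ a b : P, a ≤ b ∨ b ≤ a)
    (h₁ : ∀ a b c : W₁, a ≤ c → b ≤ c → a ≤ b ∨ b ≤ a)
    (h₂ : ∀ a b c : W₂, a ≤ c → b ≤ c → a ≤ b ∨ b ≤ a) (a b c : Glue P W₁ W₂) :
    a ≤ c → b ≤ c → a ≤ b ∨ b ≤ a := by
  rcases c with c | ⟨c, x⟩ | c
  · rcases a with a | ⟨a, y⟩ | a <;> rcases b with b | ⟨b, z⟩ | b <;> simp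
    exact hP a b c
  · rcases a with a | ⟨a, y⟩ | a <;> rcases b with b | ⟨b, z⟩ | b <;> simp
    · exact hP a b c
    · grind
    · grind
    · rintro rfl hy rfl hz
      simpa using h₁ y z x hy hz
  · rcases a with a | ⟨a, y⟩ | a <;> rcases b with b | ⟨b, z⟩ | b <;> simp
    · rcases hPW with h | h
      exacts [h.elim c, h a b]
    · exact h₂ a b c

theorem realized {M : ℕ} [Nonempty P] {τ : P → List ℕ} {L₁ : W₁ → ℕ → Prop}
    {L₂ : W₂ → ℕ → Prop} {s : State}
    (hP : ∀ a b c : P, a ≤ c → b ≤ c → a ≤ b ∨ b ≤ a)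
    (hPW : IsEmpty W₂ ∨ ∀ a b : P, a ≤ b ∨ b ≤ a)
    (h₁ : Labelled M L₁) (h₂ : Labelled M L₂) (hτ : ∀ p, Coherent M (τ p) s)
    (mem_fst : ∀ v, ∀ i < M, label τ L₁ L₂ v i → i ∈ s.1)
    (of_mem_fst : ∀ p, ∀ i < M, i ∈ s.1 → ∃ v, base p ≤ v ∧ label τ L₁ L₂ v i)
    (mem_snd : ∀ v₁ v₂, ∀ i < M, tag i = 4 → SepW v₁ v₂ → label τ L₁ L₂ v₁ (lft i) →
      label τ L₁ L₂ v₂ (rgt i) → i ∈ s.2)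
    (of_mem_snd : ∀ p, ∀ i < M, i ∈ s.2 → tag i = 4 ∧ ∃ v₁ v₂, BifRel (base p) v₁ v₂ ∧
      label τ L₁ L₂ v₁ (lft i) ∧ label τ L₁ L₂ v₂ (rgt i)) :
    Realized M s := by
  have neg : ∀ w, ∀ i < M, tag i = 1 → (label τ L₁ L₂ w i ↔ ¬ label τ L₁ L₂ w (arg i)) := by
    rintro (p | ⟨p, x⟩ | z) i hi ht
    exacts [(hτ p i hi).2.1 ht, h₁.neg x i hi ht, h₂.neg z i hi ht]
  refine ⟨Glue P W₁ W₂, inferInstance, label τ L₁ L₂,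
    ⟨forest hP hPW h₁.forest h₂.forest, neg, ?_, ?_, ?_⟩, fun i hi => ⟨?_, ?_⟩⟩
  · rintro (p | ⟨p, x⟩ | z) i hi ht
    exacts [(hτ p i hi).2.2.1 ht, h₁.conj x i hi ht, h₂.conj z i hi ht]
  · rintro (p | ⟨p, x⟩ | z) i hi ht
    · have hlt := (pair_one_arg_lt ht).trans hi
      have hneg := fun v => neg v _ hlt (tag_pair _ _)
      simp only [arg_pair] at hneg
      refine ((hτ p i hi).2.2.2.1 ht).trans ⟨fun h v _ => ?_, fun h hmem => ?_⟩
      · by_contra hv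
        exact h (mem_fst v _ hlt ((hneg v).2 hv))
      · obtain ⟨v, hv, hl⟩ := of_mem_fst p _ hlt hmem
        exact (hneg v).1 hl (h v hv)
    · refine (h₁.box x i hi ht).trans ⟨fun h v hv => ?_, fun h y hy => h (side p y) ⟨rfl, hy⟩⟩
      rcases v with q | ⟨q, y⟩ | z
      exacts [hv.elim, h y hv.2, hv.elim]
    · refine (h₂.box z i hi ht).trans ⟨fun h v hv => ?_, fun h y hy => h (top y) hy⟩
      rcases v with q | ⟨q, y⟩ | u
      exacts [hv.elim, hv.elim, h u hv]
  · rintro (p | ⟨p, x⟩ | z) i hi ht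
    · refine ((hτ p i hi).2.2.2.2 ht).trans ⟨fun h => (of_mem_snd p i hi h).2, ?_⟩
      rintro ⟨v₁, v₂, ⟨-, -, hs⟩, hl₁, hl₂⟩
      exact mem_snd v₁ v₂ i hi ht hs hl₁ hl₂
    · refine (h₁.star x i hi ht).trans ⟨?_, ?_⟩
      · rintro ⟨y₁, y₂, ⟨hy₁, hy₂, hs⟩, hl⟩
        exact ⟨side p y₁, side p y₂, ⟨⟨rfl, hy₁⟩, ⟨rfl, hy₂⟩, by simpa [SepW] using hs⟩, hl⟩
      · rintro ⟨v₁, v₂, ⟨hv₁, hv₂, hs⟩, hl⟩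
        rcases v₁ with q₁ | ⟨q₁, y₁⟩ | u₁ <;> rcases v₂ with q₂ | ⟨q₂, y₂⟩ | u₂ <;>
          simp at hv₁ hv₂
        obtain ⟨rfl, hy₁⟩ := hv₁
        obtain ⟨rfl, hy₂⟩ := hv₂
        exact ⟨y₁, y₂, ⟨hy₁, hy₂, by simpa [SepW] using hs⟩, hl⟩
    · refine (h₂.star z i hi ht).trans ⟨?_, ?_⟩
      · rintro ⟨y₁, y₂, ⟨hy₁, hy₂, hs⟩, hl⟩
        exact ⟨top y₁, top y₂, ⟨hy₁, hy₂, by simpa [SepW] using hs⟩, hl⟩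
      · rintro ⟨v₁, v₂, ⟨hv₁, hv₂, hs⟩, hl⟩
        rcases v₁ with q₁ | ⟨q₁, y₁⟩ | u₁ <;> rcases v₂ with q₂ | ⟨q₂, y₂⟩ | u₂ <;>
          simp at hv₁ hv₂
        exact ⟨u₁, u₂, ⟨hv₁, hv₂, by simpa [SepW] using hs⟩, hl⟩
  · constructor
    · intro h
      obtain ⟨v, -, hl⟩ := of_mem_fst (Classical.arbitrary P) i hi h
      exact ⟨v, trivial, hl⟩
    · rintro ⟨v, -, hl⟩
      exact mem_fst v i hi hl
  · constructor
    · intro h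
      obtain ⟨ht, v₁, v₂, ⟨-, -, hs⟩, hl⟩ := of_mem_snd (Classical.arbitrary P) i hi h
      exact ⟨ht, v₁, trivial, v₂, trivial, hs, hl⟩
    · rintro ⟨ht, v₁, -, v₂, -, hs, hl₁, hl₂⟩
      exact mem_snd v₁ v₂ i hi ht hs hl₁ hl₂

end Glue

theorem Realized.chain {M : ℕ} {s₁ s₂ s : State} (h₁ : Realized M s₁) (h₂ : Realized M s₂)
    (h : ChainStep M s₁ s₂ s) : Realized M s := by
  obtain ⟨W₁, _, L₁, hL₁, hs₁⟩ := h₁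
  obtain ⟨W₂, _, L₂, hL₂, hs₂⟩ := h₂
  obtain ⟨⟨⟨t₀, ht₀, hc₀⟩, hcov⟩, hstar⟩ := h
  let T := {t : List ℕ // t ∈ codeLists M ∧ Coherent M t s}
  have : Nonempty T := ⟨⟨t₀, ht₀, hc₀⟩⟩
  obtain ⟨f, hf⟩ := exists_surjective_nat T
  let τ : ℕ → List ℕ := fun n => (f n.unpair.1).1
  have hτ : ∀ n, Coherent M (τ n) s := fun n => (f n.unpair.1).2.2
  have hτ' : ∀ n, ∀ t ∈ codeLists M, Coherent M t s → ∃ m, n < m ∧ τ m = t := by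
    intro n t ht hc
    obtain ⟨k, hk⟩ := hf ⟨t, ht, hc⟩
    exact ⟨Nat.pair k (n + 1), Nat.right_le_pair _ _, by simp [τ, hk]⟩
  have mem_fst : ∀ v : Glue ℕ W₁ W₂, ∀ i < M, Glue.label τ L₁ L₂ v i → i ∈ s.1 := by
    rintro (n | ⟨n, x⟩ | z) i hi hl
    · exact (hτ n i hi).1 hl
    · exact (hcov i hi).1 (.inl ((hs₁.mem_fst hi).2 ⟨x, hl⟩))
    · exact (hcov i hi).1 (.inr ((hs₂.mem_fst hi).2 ⟨z, hl⟩))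
  have of_mem : ∀ n, ∀ i < M, i ∈ s.1 →
      ∃ v : Glue ℕ W₁ W₂, .base (n + 1) ≤ v ∧ Glue.label τ L₁ L₂ v i := by
    intro n i hi h
    rcases (hcov i hi).2 h with h' | h' | ⟨t, ht, hc, hit⟩
    · obtain ⟨x, hx⟩ := (hs₁.mem_fst hi).1 h'
      exact ⟨.side (n + 1) x, by simp, hx⟩
    · obtain ⟨z, hz⟩ := (hs₂.mem_fst hi).1 h'
      exact ⟨.top z, by simp, hz⟩
    · obtain ⟨m, hm, rfl⟩ := hτ' n t ht hc
      exact ⟨.base m, by simpa using hm, hit⟩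
  have hstep : ∀ n, (Glue.base n : Glue ℕ W₁ W₂) ≤ .base (n + 1) := by simp
  have hsep : ∀ n x, ∀ v : Glue ℕ W₁ W₂, .base (n + 1) ≤ v → SepW (.side n x) v := by
    rintro n x (m | ⟨m, y⟩ | z) hv <;> simp [SepW] at hv ⊢ <;> omega
  refine Glue.realized (W₁ := W₁) (W₂ := W₂) (L₁ := L₁) (L₂ := L₂) (τ := τ)
    (fun a b _ _ _ => le_total a b) (.inr le_total) hL₁ hL₂ hτ mem_fst ?_ ?_ ?_
  · intro n i hi h
    obtain ⟨v, hv, hl⟩ := of_mem n i hi h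
    exact ⟨v, (hstep n).trans hv, hl⟩
  · intro v₁ v₂ i hi ht hs hl hr
    have b₁ := (lft_lt (i := i) (by omega)).trans hi
    have b₂ := (rgt_lt (i := i) (by omega)).trans hi
    have m₁ := mem_fst _ _ b₁ hl
    have m₂ := mem_fst _ _ b₂ hr
    rw [hstar i hi]
    rcases v₁ with n | ⟨n, x⟩ | z
    · rcases v₂ with m | ⟨m, y⟩ | u
      · rcases le_total n m with h | h
        exacts [absurd h hs.1, absurd h hs.2]
      · exact .inr ⟨ht, .inr ⟨m₁, (hs₁.mem_fst b₂).2 ⟨y, hr⟩⟩⟩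
      · exact absurd trivial hs.1
    · exact .inr ⟨ht, .inl ⟨(hs₁.mem_fst b₁).2 ⟨x, hl⟩, m₂⟩⟩
    · rcases v₂ with m | ⟨m, y⟩ | u
      · exact absurd trivial hs.2
      · exact .inr ⟨ht, .inr ⟨m₁, (hs₁.mem_fst b₂).2 ⟨y, hr⟩⟩⟩
      · exact .inl ((hs₂.mem_snd hi).2 ⟨ht, z, u, by simpa [SepW] using hs, hl, hr⟩)
  · intro n i hi h
    rcases (hstar i hi).1 h with h' | ⟨ht, ⟨hl, hr⟩ | ⟨hl, hr⟩⟩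
    · obtain ⟨ht, z, u, hs, hl⟩ := (hs₂.mem_snd hi).1 h'
      exact ⟨ht, .top z, .top u, ⟨trivial, trivial, by simpa [SepW] using hs⟩, hl⟩
    · have b₁ := (lft_lt (i := i) (by omega)).trans hi
      have b₂ := (rgt_lt (i := i) (by omega)).trans hi
      obtain ⟨x, hx⟩ := (hs₁.mem_fst b₁).1 hl
      obtain ⟨v, hv, hvr⟩ := of_mem n _ b₂ hr
      exact ⟨ht, .side n x, v, ⟨by simp, (hstep n).trans hv, hsep n x v hv⟩, hx, hvr⟩
    · have b₁ := (lft_lt (i := i) (by omega)).trans hi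
      have b₂ := (rgt_lt (i := i) (by omega)).trans hi
      obtain ⟨x, hx⟩ := (hs₁.mem_fst b₂).1 hr
      obtain ⟨v, hv, hvl⟩ := of_mem n _ b₁ hl
      exact ⟨ht, v, .side n x, ⟨(hstep n).trans hv, by simp, (hsep n x v hv).symm⟩, hvl, hx⟩

/-- Finite sequences over `α`, ordered by extension. -/
structure Path (α : Type) : Type where
  toList : List α

instance (α : Type) : PartialOrder (Path α) where
  le a b := a.toList <:+ b.toList
  le_refl a := List.suffix_rfl
  le_trans a b c := List.IsSuffix.trans
  le_antisymm := by
    rintro ⟨a⟩ ⟨b⟩ h₁ h₂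
    exact congrArg Path.mk (h₁.eq_of_length (le_antisymm h₁.length_le h₂.length_le))

theorem Path.le_def {α : Type} {a b : Path α} : a ≤ b ↔ a.toList <:+ b.toList := Iff.rfl

theorem Path.sep_cons {α : Type} {a b : α} (l : List α) (h : a ≠ b) :
    SepW (Path.mk (a :: l)) (Path.mk (b :: l)) := by
  have key : ∀ {a b : α}, a ≠ b → ¬ Path.mk (a :: l) ≤ Path.mk (b :: l) := by
    intro a b h hle
    have := (Path.le_def.1 hle).eq_of_length (by simp)
    exact h (List.cons.inj this).1
  exact ⟨key h, key h.symm⟩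

theorem Realized.branch {M : ℕ} {s₁ s : State} (h₁ : Realized M s₁) (h : BranchStep M s₁ s) :
    Realized M s := by
  obtain ⟨W₁, _, L₁, hL₁, hs₁⟩ := h₁
  let L₂ : PEmpty → ℕ → Prop := fun _ _ => False
  obtain ⟨⟨⟨t₀, ht₀, hc₀⟩, hcov⟩, hstar⟩ := h
  let T := {t : List ℕ // t ∈ codeLists M ∧ Coherent M t s}
  let root : T := ⟨t₀, ht₀, hc₀⟩
  let τ : Path (Bool × T) → List ℕ := fun a => ((a.toList.head?.map Prod.snd).getD root).1
  have hτ : ∀ a, Coherent M (τ a) s := fun a => ((a.toList.head?.map Prod.snd).getD root).2.2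
  have mem_fst : ∀ v : Glue (Path (Bool × T)) W₁ PEmpty, ∀ i < M,
      Glue.label τ L₁ L₂ v i → i ∈ s.1 := by
    rintro (n | ⟨n, x⟩ | z) i hi hl
    · exact (hτ n i hi).1 hl
    · exact (hcov i hi).1 (.inl ((hs₁.mem_fst hi).2 ⟨x, hl⟩))
    · exact z.elim
  have of_mem : ∀ (l : List (Bool × T)) (c : Bool), ∀ i < M, i ∈ s.1 →
      ∃ (t : T) (v : Glue (Path (Bool × T)) W₁ PEmpty),
        .base ⟨(c, t) :: l⟩ ≤ v ∧ Glue.label τ L₁ L₂ v i := by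
    intro l c i hi h
    rcases (hcov i hi).2 h with h' | h' | ⟨t, ht, hc, hit⟩
    · obtain ⟨x, hx⟩ := (hs₁.mem_fst hi).1 h'
      exact ⟨root, .side ⟨(c, root) :: l⟩ x, by simp, hx⟩
    · obtain ⟨x, hx⟩ := (hs₁.mem_fst hi).1 h'
      exact ⟨root, .side ⟨(c, root) :: l⟩ x, by simp, hx⟩
    · exact ⟨⟨t, ht, hc⟩, .base _, le_rfl, hit⟩
  have hstep : ∀ a l, (Glue.base ⟨l⟩ : Glue (Path (Bool × T)) W₁ PEmpty) ≤ .base ⟨a :: l⟩ :=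
    fun a l => List.suffix_cons a l
  have hforest : ∀ a b c : Path (Bool × T), a ≤ c → b ≤ c → a ≤ b ∨ b ≤ a :=
    fun a b c => List.suffix_or_suffix_of_suffix
  have : Nonempty (Path (Bool × T)) := ⟨⟨[]⟩⟩
  refine Glue.realized (W₁ := W₁) (W₂ := PEmpty) (L₁ := L₁) (L₂ := L₂) (τ := τ)
    hforest (.inl inferInstance) hL₁ (labelled_of_isEmpty _) hτ mem_fst ?_ ?_ ?_
  · rintro ⟨l⟩ i hi h
    obtain ⟨t, v, hv, hl⟩ := of_mem l true i hi h
    exact ⟨v, (hstep _ l).trans hv, hl⟩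
  · intro v₁ v₂ i hi ht hs hl hr
    exact (hstar i hi).2 ⟨ht, mem_fst _ _ ((lft_lt (by omega)).trans hi) hl,
      mem_fst _ _ ((rgt_lt (by omega)).trans hi) hr⟩
  · rintro ⟨l⟩ i hi h
    obtain ⟨ht, hl, hr⟩ := (hstar i hi).1 h
    obtain ⟨t₁, v₁, hv₁, hl₁⟩ := of_mem l true _ ((lft_lt (by omega)).trans hi) hl
    obtain ⟨t₂, v₂, hv₂, hl₂⟩ := of_mem l false _ ((rgt_lt (by omega)).trans hi) hr
    refine ⟨ht, v₁, v₂, ⟨(hstep _ l).trans hv₁, (hstep _ l).trans hv₂, ?_⟩, hl₁, hl₂⟩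
    have hsep : SepW (Path.mk ((true, t₁) :: l)) (Path.mk ((false, t₂) :: l)) :=
      Path.sep_cons l (by simp)
    have hF := Glue.forest (W₁ := W₁) (W₂ := PEmpty) hforest (.inl inferInstance) hL₁.forest
      (fun a => a.elim)
    exact SepW.mono hF (by simpa [SepW] using hsep) hv₁ hv₂

theorem Realized.step {M : ℕ} {s₁ s₂ s : State} (h₁ : Realized M s₁) (h₂ : Realized M s₂)
    (h : Step M s₁ s₂ s) : Realized M s := by
  rcases h with h | h | h
  exacts [h₁.union h₂ h, h₁.chain h₂ h, h₁.branch h]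

open Classical in
/-- The list of the realized states. -/
noncomputable def realizedStates (M : ℕ) : List State :=
  (states M).filter fun s => Realized M s

theorem mem_realizedStates {M : ℕ} {s : State} :
    s ∈ realizedStates M ↔ s ∈ states M ∧ Realized M s := by
  simp [realizedStates]

theorem closed_realizedStates (M : ℕ) : Closed M (realizedStates M) := by
  refine ⟨mem_realizedStates.2 ⟨by simp [states, codeLists], realized_empty M⟩, ?_⟩
  intro s₁ h₁ s₂ h₂ s hs h
  exact mem_realizedStates.2
    ⟨hs, (mem_realizedStates.1 h₁).2.step (mem_realizedStates.1 h₂).2 h⟩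

end Completeness

section Decoding

/-- The formula coded by `i`, provided that it is `—∗`-free. -/
def decode (i : ℕ) : BLForm :=
  if _h : tag i = 1 then .neg (decode (arg i))
  else if _h : tag i = 2 then .conj (decode (lft i)) (decode (rgt i))
  else if _h : tag i = 3 then .box (decode (arg i))
  else if _h : tag i = 4 then .star (decode (lft i)) (decode (rgt i))
  else .atom (arg i)
termination_by i
decreasing_by
  all_goals first
    | exact arg_lt (by omega)
    | exact lft_lt (by omega)
    | exact rgt_lt (by omega)

theorem decode_encBL : ∀ {A : BLForm}, WandFree A → decode (encBL A) = A
  | .atom p, _ => by rw [encBL, decode]; simp [tag_pair, arg_pair]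
  | .neg A, h => by rw [encBL, decode]; simp [tag_pair, arg_pair, decode_encBL (A := A) h]
  | .conj A B, h => by
    rw [encBL, decode]; simp [tag_pair, lft_pair, rgt_pair, decode_encBL h.1, decode_encBL h.2]
  | .box A, h => by rw [encBL, decode]; simp [tag_pair, arg_pair, decode_encBL (A := A) h]
  | .star A B, h => by
    rw [encBL, decode]; simp [tag_pair, lft_pair, rgt_pair, decode_encBL h.1, decode_encBL h.2]

theorem BLModel.forest {W : Type} [PartialOrder W] (m : BLModel W) (a b c : W) (ha : a ≤ c)
    (hb : b ≤ c) : a ≤ b ∨ b ≤ a := by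
  by_contra h
  rw [not_or] at h
  exact (m.persist a b c h ha).2 hb

theorem BLModel.labelled {W : Type} [PartialOrder W] (m : BLModel W) (M : ℕ) :
    Labelled M fun w i => Sat m.V (decode i) w := by
  refine ⟨BLModel.forest m, ?_, ?_, ?_, ?_⟩ <;> intro w i _ ht <;> rw [decode] <;> simp [ht, Sat]

variable {M : ℕ} {W : Type} [PartialOrder W] {L : W → ℕ → Prop}

theorem Labelled.sat_iff (hL : Labelled M L) : ∀ {A : BLForm}, WandFree A → encBL A < M →
    ∀ w, Sat (fun w p => L w (Nat.pair 0 p)) A w ↔ L w (encBL A)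
  | .atom p, _, _, w => Iff.rfl
  | .neg A, hA, hM, w => by
    rw [encBL] at hM ⊢
    have h := arg_lt (i := Nat.pair 1 (encBL A)) (by simp [tag_pair])
    rw [arg_pair] at h
    rw [hL.neg w _ hM (tag_pair _ _), arg_pair, Sat, hL.sat_iff (A := A) hA (h.trans hM)]
  | .conj A B, hA, hM, w => by
    rw [encBL] at hM ⊢
    have h := lft_lt (i := Nat.pair 2 (Nat.pair (encBL A) (encBL B))) (by simp [tag_pair])
    have h' := rgt_lt (i := Nat.pair 2 (Nat.pair (encBL A) (encBL B))) (by simp [tag_pair])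
    rw [lft_pair] at h
    rw [rgt_pair] at h'
    rw [hL.conj w _ hM (tag_pair _ _), lft_pair, rgt_pair, Sat, hL.sat_iff hA.1 (h.trans hM),
      hL.sat_iff hA.2 (h'.trans hM)]
  | .box A, hA, hM, w => by
    rw [encBL] at hM ⊢
    have h := arg_lt (i := Nat.pair 3 (encBL A)) (by simp [tag_pair])
    rw [arg_pair] at h
    simp only [hL.box w _ hM (tag_pair _ _), arg_pair, Sat,
      hL.sat_iff (A := A) hA (h.trans hM)]
  | .star A B, hA, hM, w => by
    rw [encBL] at hM ⊢
    have h := lft_lt (i := Nat.pair 4 (Nat.pair (encBL A) (encBL B))) (by simp [tag_pair])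
    have h' := rgt_lt (i := Nat.pair 4 (Nat.pair (encBL A) (encBL B))) (by simp [tag_pair])
    rw [lft_pair] at h
    rw [rgt_pair] at h'
    simp only [hL.star w _ hM (tag_pair _ _), lft_pair, rgt_pair, Sat,
      hL.sat_iff hA.1 (h.trans hM), hL.sat_iff hA.2 (h'.trans hM)]

theorem Labelled.restrict (hL : Labelled M L) (w : W) :
    Labelled M fun (v : Set.Ici w) i => L v i := by
  refine ⟨fun a b c => hL.forest a b c, fun v => hL.neg v, fun v => hL.conj v, ?_, ?_⟩
  · intro v i hi ht
    refine (hL.box v i hi ht).trans ⟨fun h u hu => h u hu, fun h u hu => ?_⟩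
    exact h ⟨u, v.2.trans hu⟩ hu
  · intro v i hi ht
    refine (hL.star v i hi ht).trans ⟨?_, ?_⟩
    · rintro ⟨v₁, v₂, ⟨h₁, h₂, hs⟩, hl⟩
      exact ⟨⟨v₁, v.2.trans h₁⟩, ⟨v₂, v.2.trans h₂⟩, ⟨h₁, h₂, hs⟩, hl⟩
    · rintro ⟨v₁, v₂, h, hl⟩
      exact ⟨v₁, v₂, h, hl⟩

/-- Some closed set of states refutes the negation of the formula coded by `n`. -/
def Refutable (n : ℕ) : Prop :=
  ∃ R ∈ (states (Nat.pair 1 n + 1)).sublists', Closed (Nat.pair 1 n + 1) R ∧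
    ∀ s ∈ R, Nat.pair 1 n ∉ s.1

theorem refutable_encBL_iff {A : BLForm} (hA : WandFree A) :
    Refutable (encBL A) ↔ BLValid A := by
  set i := Nat.pair 1 (encBL A) with hi
  constructor
  · rintro ⟨R, -, hR, hn⟩ W _ m w
    have hL := BLModel.labelled m (i + 1)
    have hmem := hn _ (hL.stateOf_Ici_mem hR _ w rfl)
    have hneg : Sat m.V (decode i) w ↔ ¬ Sat m.V A w := by
      have h := decode_encBL (A := .neg A) hA
      rw [encBL] at h
      rw [hi, h, Sat]
    by_contra h
    exact hmem (mem_stateOf_fst.2 ⟨Nat.lt_succ_self _, w, le_rfl, hneg.2 h⟩)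
  · intro hV
    refine ⟨realizedStates (i + 1), ?_, closed_realizedStates _, fun s hs hmem => ?_⟩
    · simp [realizedStates, hi]
    · obtain ⟨W, _, L, hL, hst⟩ := (mem_realizedStates.1 hs).2
      obtain ⟨w, hw⟩ := (hst.mem_fst (Nat.lt_succ_self _)).1 hmem
      have hL' := hL.restrict w
      let m : BLModel (Set.Ici w) :=
        { rooted := ⟨⟨w, le_rfl⟩, fun v => v.2⟩
          persist := fun a b c h hc => SepW.mono hL'.forest h hc le_rfl
          V := fun v p => L v (Nat.pair 0 p) }
      have hsat := (hL'.sat_iff hA ((Nat.right_le_pair 1 _).trans_lt (Nat.lt_succ_self _))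
        ⟨w, le_rfl⟩).1 (hV _ m ⟨w, le_rfl⟩)
      rw [hL.neg w i (Nat.lt_succ_self _) (tag_pair _ _), hi, arg_pair] at hw
      exact hw hsat

end Decoding

section Computability

variable {α β : Type*} [Primcodable α] [Primcodable β]

theorem primrecPred_imp {p q : α → Prop} (hp : PrimrecPred p) (hq : PrimrecPred q) :
    PrimrecPred fun a => p a → q a :=
  (hp.not.or hq).of_eq fun _ => imp_iff_not_or.symm

theorem primrecPred_iff {p q : α → Prop} (hp : PrimrecPred p) (hq : PrimrecPred q) :
    PrimrecPred fun a => p a ↔ q a :=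
  ((primrecPred_imp hp hq).and (primrecPred_imp hq hp)).of_eq fun _ =>
    iff_iff_implies_and_implies.symm

theorem primrecPred_forall_mem {f : α → List β} {p : α → β → Prop} (hf : Primrec f)
    (hp : PrimrecPred fun x : β × α => p x.2 x.1) : PrimrecPred fun a => ∀ b ∈ f a, p a b :=
  (PrimrecRel.forall_mem_list (R := fun b a => p a b) hp.primrecRel).comp hf Primrec.id

theorem primrecPred_exists_mem {f : α → List β} {p : α → β → Prop} (hf : Primrec f)
    (hp : PrimrecPred fun x : β × α => p x.2 x.1) : PrimrecPred fun a => ∃ b ∈ f a, p a b :=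
  (PrimrecRel.exists_mem_list (R := fun b a => p a b) hp.primrecRel).comp hf Primrec.id

theorem primrecPred_forall_lt {f : α → ℕ} {p : α → ℕ → Prop} (hf : Primrec f)
    (hp : PrimrecPred fun x : ℕ × α => p x.2 x.1) : PrimrecPred fun a => ∀ i < f a, p a i :=
  (primrecPred_forall_mem (Primrec.list_range.comp hf) hp).of_eq fun a => by simp

theorem primrecPred_mem {f : α → β} {g : α → List β} (hf : Primrec f) (hg : Primrec g) :
    PrimrecPred fun a => f a ∈ g a :=
  (primrecPred_exists_mem (p := fun a b => b = f a) hg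
    (Primrec.eq.comp Primrec.fst (hf.comp Primrec.snd))).of_eq fun a => by simp

theorem primrec_sublists' : Primrec (List.sublists' : List β → List (List β)) := by
  have hstep : Primrec₂ fun (_ : List β) (x : β × List (List β)) =>
      x.2 ++ x.2.map (List.cons x.1) :=
    Primrec.list_append.comp (Primrec.snd.comp Primrec.snd)
      (Primrec.list_map (Primrec.snd.comp Primrec.snd)
        (Primrec.list_cons.comp ((Primrec.fst.comp Primrec.snd).comp Primrec.fst) Primrec.snd))
  refine (Primrec.list_foldr Primrec.id (Primrec.const [[]]) hstep).of_eq fun l => ?_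
  induction l with
  | nil => rfl
  | cons a l ih => simpa using congrArg (fun r => r ++ r.map (List.cons a)) ih

theorem primrec_codeLists : Primrec codeLists := primrec_sublists'.comp Primrec.list_range

theorem primrec_states : Primrec states :=
  Primrec.list_flatMap primrec_codeLists
    (Primrec.list_map (primrec_codeLists.comp Primrec.fst)
      (Primrec.pair (Primrec.snd.comp Primrec.fst) Primrec.snd))

theorem primrec_tag : Primrec tag := Primrec.fst.comp Primrec.unpair

theorem primrec_arg : Primrec arg := Primrec.snd.comp Primrec.unpair

theorem primrec_lft : Primrec lft := Primrec.fst.comp (Primrec.unpair.comp primrec_arg)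

theorem primrec_rgt : Primrec rgt := Primrec.snd.comp (Primrec.unpair.comp primrec_arg)

variable {M i : α → ℕ} {t : α → List ℕ} {s s₁ s₂ : α → State} {R : α → List State}

theorem primrecPred_tag (k : ℕ) (hi : Primrec i) : PrimrecPred fun a => tag (i a) = k :=
  Primrec.eq.comp (primrec_tag.comp hi) (Primrec.const k)

theorem primrecPred_coherentAt (hi : Primrec i) (ht : Primrec t) (hs : Primrec s) :
    PrimrecPred fun a => CoherentAt (i a) (t a) (s a) := by
  have hs₁ := Primrec.fst.comp hs
  have hs₂ := Primrec.snd.comp hs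
  have harg := primrec_arg.comp hi
  have hit := primrecPred_mem hi ht
  exact (primrecPred_imp hit (primrecPred_mem hi hs₁)).and <|
    (primrecPred_imp (primrecPred_tag 1 hi)
      (primrecPred_iff hit (primrecPred_mem harg ht).not)).and <|
    (primrecPred_imp (primrecPred_tag 2 hi) (primrecPred_iff hit
      ((primrecPred_mem (primrec_lft.comp hi) ht).and
        (primrecPred_mem (primrec_rgt.comp hi) ht)))).and <|
    (primrecPred_imp (primrecPred_tag 3 hi) (primrecPred_iff hit
      (primrecPred_mem (Primrec₂.natPair.comp (Primrec.const 1) harg) hs₁).not)).and <|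
    primrecPred_imp (primrecPred_tag 4 hi) (primrecPred_iff hit (primrecPred_mem hi hs₂))

theorem primrecPred_coherent (hM : Primrec M) (ht : Primrec t) (hs : Primrec s) :
    PrimrecPred fun a => Coherent (M a) (t a) (s a) :=
  primrecPred_forall_lt hM <| primrecPred_coherentAt Primrec.fst (ht.comp Primrec.snd)
    (hs.comp Primrec.snd)

theorem primrecPred_covers (hM : Primrec M) (h₁ : Primrec s₁) (h₂ : Primrec s₂)
    (hs : Primrec s) : PrimrecPred fun a => Covers (M a) (s₁ a) (s₂ a) (s a) := by
  refine (primrecPred_exists_mem (primrec_codeLists.comp hM)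
    (primrecPred_coherent (hM.comp Primrec.snd) Primrec.fst (hs.comp Primrec.snd))).and
    (primrecPred_forall_lt hM ?_)
  have mem : ∀ {r : α → State}, Primrec r → PrimrecPred fun x : ℕ × α => x.1 ∈ (r x.2).1 :=
    fun hr => primrecPred_mem Primrec.fst (Primrec.fst.comp (hr.comp Primrec.snd))
  have hM' := hM.comp (Primrec.snd (α := ℕ))
  refine (primrecPred_imp ((mem h₁).or (mem h₂)) (mem hs)).and
    (primrecPred_imp (mem hs) ((mem h₁).or ((mem h₂).or
      (primrecPred_exists_mem (primrec_codeLists.comp hM') ?_))))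
  exact (primrecPred_coherent (hM'.comp Primrec.snd) Primrec.fst
    ((hs.comp Primrec.snd).comp Primrec.snd)).and
      (primrecPred_mem (Primrec.fst.comp Primrec.snd) Primrec.fst)

theorem primrecPred_unionStep (hM : Primrec M) (h₁ : Primrec s₁) (h₂ : Primrec s₂)
    (hs : Primrec s) : PrimrecPred fun a => UnionStep (M a) (s₁ a) (s₂ a) (s a) := by
  have mem₁ : ∀ {f : ℕ → ℕ} {r : α → State}, Primrec f → Primrec r →
      PrimrecPred fun x : ℕ × α => f x.1 ∈ (r x.2).1 := fun hf hr =>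
    primrecPred_mem (hf.comp Primrec.fst) (Primrec.fst.comp (hr.comp Primrec.snd))
  have mem₂ : ∀ {r : α → State}, Primrec r → PrimrecPred fun x : ℕ × α => x.1 ∈ (r x.2).2 :=
    fun hr => primrecPred_mem Primrec.fst (Primrec.snd.comp (hr.comp Primrec.snd))
  exact primrecPred_forall_lt hM <|
    (primrecPred_iff (mem₁ Primrec.id hs) ((mem₁ Primrec.id h₁).or (mem₁ Primrec.id h₂))).and <|
    primrecPred_iff (mem₂ hs) <| (mem₂ h₁).or <| (mem₂ h₂).or <|
      (primrecPred_tag 4 Primrec.fst).and <|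
        ((mem₁ primrec_lft h₁).and (mem₁ primrec_rgt h₂)).or
          ((mem₁ primrec_lft h₂).and (mem₁ primrec_rgt h₁))

theorem primrecPred_chainStep (hM : Primrec M) (h₁ : Primrec s₁) (h₂ : Primrec s₂)
    (hs : Primrec s) : PrimrecPred fun a => ChainStep (M a) (s₁ a) (s₂ a) (s a) := by
  have mem₁ : ∀ {f : ℕ → ℕ} {r : α → State}, Primrec f → Primrec r →
      PrimrecPred fun x : ℕ × α => f x.1 ∈ (r x.2).1 := fun hf hr =>
    primrecPred_mem (hf.comp Primrec.fst) (Primrec.fst.comp (hr.comp Primrec.snd))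
  have mem₂ : ∀ {r : α → State}, Primrec r → PrimrecPred fun x : ℕ × α => x.1 ∈ (r x.2).2 :=
    fun hr => primrecPred_mem Primrec.fst (Primrec.snd.comp (hr.comp Primrec.snd))
  exact (primrecPred_covers hM h₁ h₂ hs).and <| primrecPred_forall_lt hM <|
    primrecPred_iff (mem₂ hs) <| (mem₂ h₂).or <|
      (primrecPred_tag 4 Primrec.fst).and <|
        ((mem₁ primrec_lft h₁).and (mem₁ primrec_rgt hs)).or
          ((mem₁ primrec_lft hs).and (mem₁ primrec_rgt h₁))

theorem primrecPred_branchStep (hM : Primrec M) (h₁ : Primrec s₁) (hs : Primrec s) :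
    PrimrecPred fun a => BranchStep (M a) (s₁ a) (s a) := by
  have mem₁ : ∀ {f : ℕ → ℕ}, Primrec f → PrimrecPred fun x : ℕ × α => f x.1 ∈ (s x.2).1 :=
    fun hf => primrecPred_mem (hf.comp Primrec.fst) (Primrec.fst.comp (hs.comp Primrec.snd))
  exact (primrecPred_covers hM h₁ h₁ hs).and <| primrecPred_forall_lt hM <|
    primrecPred_iff (primrecPred_mem Primrec.fst (Primrec.snd.comp (hs.comp Primrec.snd))) <|
      (primrecPred_tag 4 Primrec.fst).and <| (mem₁ primrec_lft).and (mem₁ primrec_rgt)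

theorem primrecPred_closed (hM : Primrec M) (hR : Primrec R) :
    PrimrecPred fun a => Closed (M a) (R a) := by
  refine (primrecPred_mem (Primrec.const _) hR).and <| primrecPred_forall_mem hR <|
    primrecPred_forall_mem (hR.comp Primrec.snd) <|
    primrecPred_forall_mem (primrec_states.comp ((hM.comp Primrec.snd).comp Primrec.snd)) ?_
  have hM' : Primrec fun x : State × State × State × α => M x.2.2.2 :=
    hM.comp (Primrec.snd.comp (Primrec.snd.comp Primrec.snd))
  have hR' : Primrec fun x : State × State × State × α => R x.2.2.2 :=
    hR.comp (Primrec.snd.comp (Primrec.snd.comp Primrec.snd))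
  have h₁ : Primrec fun x : State × State × State × α => x.2.2.1 :=
    Primrec.fst.comp (Primrec.snd.comp Primrec.snd)
  have h₂ : Primrec fun x : State × State × State × α => x.2.1 := Primrec.fst.comp Primrec.snd
  exact primrecPred_imp
    ((primrecPred_unionStep hM' h₁ h₂ Primrec.fst).or <|
      (primrecPred_chainStep hM' h₁ h₂ Primrec.fst).or <|
        primrecPred_branchStep hM' h₁ Primrec.fst)
    (primrecPred_mem Primrec.fst hR')

theorem primrecPred_refutable : PrimrecPred Refutable := by
  have hn : Primrec fun n => Nat.pair 1 n := Primrec₂.natPair.comp (Primrec.const 1) Primrec.id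
  have hM : Primrec fun n => Nat.pair 1 n + 1 := Primrec.succ.comp hn
  refine primrecPred_exists_mem (primrec_sublists'.comp (primrec_states.comp hM)) <|
    (primrecPred_closed (hM.comp Primrec.snd) Primrec.fst).and <|
    primrecPred_forall_mem Primrec.fst <|
    (primrecPred_mem ?_ (Primrec.fst.comp Primrec.fst)).not
  exact (hn.comp Primrec.snd).comp Primrec.snd

end Computability

end BLDecide

/-- Decidability of the wand-free fragment of BL: there is a computable
function that, on the code of any `—∗`-free formula, decides whether that
formula is valid in BL. -/
theorem wandFree_validity_decidable :
    ∃ f : ℕ → Bool, Computable f ∧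
      ∀ A : BLForm, WandFree A → (f (encBL A) = true ↔ BLValid A) := by
  obtain ⟨_, h⟩ := BLDecide.primrecPred_refutable
  exact ⟨_, h.to_comp, fun A hA => decide_eq_true_iff.trans (BLDecide.refutable_encBL_iff hA)⟩
end
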